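/- arXiv:2211.12669 — 3 statements merged into one kernel-verified Lean document; each statement's English description precedes it below -/
import Mathlib

section
/- Let f : [0,1] → (0,∞) be a continuous probability density with cdf F(θ) = ∫₀^θ f(z) dz, F(1) = 1, let μ_F be the associated probability measure on [0,1], and let P = μ_F ⊗ μ_F on Θ² = [0,1]×[0,1]. Let 𝒬 be a set of probability measures on Θ², each absolutely continuous with respect to P, that is rearrangement invariant and contains P. Then the worst-case revenue of the first-price auction is at least that of the all-pay auction: inf_{Q ∈ 𝒬} ∬ [t^I₁(θ,θ') + t^I₂(θ',θ)] dQ ≥ inf_{Q ∈ 𝒬} ∬ [t^A₁(θ,θ') + t^A₂(θ',θ)] dQ. -/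
open MeasureTheory

noncomputable section

abbrev Θ : Type := ↥(Set.Icc (0:ℝ) 1)

/-- `ν'` is a rearrangement of `ν` with respect to `μ`. -/
def IsRearrangement {Ω : Type*} [MeasurableSpace Ω] (μ ν ν' : Measure Ω) : Prop :=
  ∀ c : ENNReal, μ {ω | ν'.rnDeriv μ ω ≤ c} = μ {ω | ν.rnDeriv μ ω ≤ c}

theorem layer_aux {Ω : Type*} [MeasurableSpace Ω] (μ : Measure Ω) (g : Ω → ENNReal)
    (hg : Measurable g) (hfin : ∀ᵐ x ∂μ, g x < ⊤) :
    ∫⁻ x, g x ∂μ = ∫⁻ t in Set.Ioi (0:ℝ), μ {x | ENNReal.ofReal t < g x} := by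
  have h1 : ∫⁻ x, g x ∂μ = ∫⁻ x, ENNReal.ofReal (g x).toReal ∂μ := by
    apply lintegral_congr_ae
    filter_upwards [hfin] with x hx
    rw [ENNReal.ofReal_toReal hx.ne]
  rw [h1, lintegral_eq_lintegral_meas_lt μ (Filter.Eventually.of_forall fun x => ENNReal.toReal_nonneg)
    hg.ennreal_toReal.aemeasurable]
  apply setLIntegral_congr_fun measurableSet_Ioi
  intro t ht
  apply measure_congr
  filter_upwards [hfin] with x hx
  apply propext
  exact (ENNReal.ofReal_lt_iff_lt_toReal (le_of_lt ht) hx.ne).symm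

theorem compare_aux {Ω : Type*} [MeasurableSpace Ω] (P : Measure Ω) (g g' X Y : Ω → ENNReal)
    (hg : Measurable g) (hg' : Measurable g') (hX : Measurable X) (hY : Measurable Y)
    (hfin : ∀ᵐ x ∂P, g x < ⊤) (hfin' : ∀ᵐ x ∂P, g' x < ⊤)
    (h : ∀ t, ∫⁻ x in {x | t < g' x}, Y x ∂P ≤ ∫⁻ x in {x | t < g x}, X x ∂P) :
    ∫⁻ x, Y x ∂(P.withDensity g') ≤ ∫⁻ x, X x ∂(P.withDensity g) := by
  have key : ∀ (g X : Ω → ENNReal), Measurable g → Measurable X → (∀ᵐ x ∂P, g x < ⊤) →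
      ∫⁻ x, X x ∂(P.withDensity g) =
        ∫⁻ t in Set.Ioi (0:ℝ), ∫⁻ x in {x | ENNReal.ofReal t < g x}, X x ∂P := by
    intro g X hg hX hfin
    rw [lintegral_withDensity_eq_lintegral_mul _ hg hX, mul_comm,
      ← lintegral_withDensity_eq_lintegral_mul _ hX hg,
      layer_aux _ g hg ((withDensity_absolutelyContinuous P X).ae_le hfin)]
    apply lintegral_congr
    intro t
    rw [withDensity_apply _ (measurableSet_lt measurable_const hg)]
  rw [key g X hg hX hfin, key g' Y hg' hY hfin']
  exact lintegral_mono fun t => h _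

theorem constr_aux {Ω : Type*} [MeasurableSpace Ω] (P : Measure Ω)
    (M g : Ω → ENNReal) (hM : Measurable M) :
    ∃ g' : Ω → ENNReal, Measurable g' ∧ ∀ t, {x | t < g' x} = {x | M x < P {x | t < g x}} := by
  set D : ENNReal → ENNReal := fun t => P {x | t < g x} with hD
  have hanti : Antitone D := fun s t hst => measure_mono fun x hx => lt_of_le_of_lt hst hx
  have hcont : ∀ t m, (∀ t', t < t' → D t' ≤ m) → D t ≤ m := by
    intro t m h
    rcases eq_or_ne t ⊤ with rfl | ht
    · simp [hD]
    obtain ⟨u, hu, hu2, hu3⟩ := exists_seq_strictAnti_tendsto' (lt_top_iff_ne_top.2 ht)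
    have : {x | t < g x} = ⋃ n, {x | u n < g x} := by
      ext x
      simp only [Set.mem_setOf_eq, Set.mem_iUnion]
      constructor
      · intro hx
        exact (hu3.eventually (gt_mem_nhds hx)).exists
      · rintro ⟨n, hn⟩
        exact (hu2 n).1.trans hn
    simp only [hD]
    rw [this, Monotone.measure_iUnion]
    · exact iSup_le fun n => h _ (hu2 n).1
    · intro a b hab x hx
      exact lt_of_le_of_lt (hu.antitone hab) hx
  have hset : ∀ t, {x | t < sInf {t | D t ≤ M x}} = {x | M x < D t} := by
    intro t
    ext x
    simp only [Set.mem_setOf_eq]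
    rw [← not_le, ← not_le, not_iff_not]
    constructor
    · intro h
      apply hcont
      intro t' ht'
      obtain ⟨s, hs, hs2⟩ := sInf_lt_iff.1 (lt_of_le_of_lt h ht')
      exact (hanti hs2.le).trans hs
    · intro h
      exact sInf_le h
  refine ⟨fun x => sInf {t | D t ≤ M x}, ?_, hset⟩
  apply measurable_of_Ioi
  intro t
  have := hset t
  change MeasurableSet {x | t < sInf {t | D t ≤ M x}}
  rw [this]
  exact measurableSet_lt hM measurable_const

theorem bathtub_aux {Ω : Type*} [MeasurableSpace Ω] (P : Measure Ω) [IsProbabilityMeasure P]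
    (X : Ω → ENNReal) (A B : Set Ω) (hA : MeasurableSet A) (hB : MeasurableSet B)
    (hAB : P A = P B) (c : ENNReal) (h1 : ∀ x ∈ A, X x ≤ c) (h2 : ∀ x, x ∉ A → c ≤ X x) :
    ∫⁻ x in A, X x ∂P ≤ ∫⁻ x in B, X x ∂P := by
  rw [← lintegral_inter_add_diff X A hB, ← lintegral_inter_add_diff X B hA, Set.inter_comm B A]
  refine add_le_add le_rfl ?_
  have e : P (A \ B) = P (B \ A) := by
    have ha := measure_inter_add_diff (μ := P) A hB
    have hb := measure_inter_add_diff (μ := P) B hA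
    rw [Set.inter_comm B A, ← hAB, ← ha] at hb
    exact ((ENNReal.add_right_inj (measure_ne_top P _)).1 hb).symm
  calc ∫⁻ x in A \ B, X x ∂P ≤ ∫⁻ x in A \ B, c ∂P :=
        setLIntegral_mono measurable_const fun x hx => h1 x hx.1
    _ = ∫⁻ x in B \ A, c ∂P := by simp [e]
    _ ≤ ∫⁻ x in B \ A, X x ∂P :=
        setLIntegral_mono' (hB.diff hA) fun x hx => h2 x hx.2

/-- The abstract core. -/
theorem core_aux {Ω : Type*} [MeasurableSpace Ω] (P : Measure Ω) [IsProbabilityMeasure P]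
    (M X Y : Ω → ENNReal) (hM : Measurable M) (hX : Measurable X) (hY : Measurable Y)
    (hMu : ∀ s ≤ 1, P {x | M x < s} = s)
    (hc : ∀ s ≤ 1, ∃ c, (∀ x, M x < s → X x ≤ c) ∧ (∀ x, ¬ M x < s → c ≤ X x))
    (hYX : ∀ s ≤ 1, ∫⁻ x in {x | M x < s}, Y x ∂P ≤ ∫⁻ x in {x | M x < s}, X x ∂P)
    (Q : Measure Ω) [IsProbabilityMeasure Q] (hQ : Q ≪ P) :
    ∃ Q' : Measure Ω, IsProbabilityMeasure Q' ∧ Q' ≪ P ∧ IsRearrangement P Q Q' ∧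
      ∫⁻ x, Y x ∂Q' ≤ ∫⁻ x, X x ∂Q := by
  set g := Q.rnDeriv P with hgdef
  have hg : Measurable g := Measure.measurable_rnDeriv Q P
  have hQg : P.withDensity g = Q := Measure.withDensity_rnDeriv_eq Q P hQ
  obtain ⟨g', hg', hset⟩ := constr_aux P M g hM
  have hlt : ∀ t, P {x | t < g' x} = P {x | t < g x} := by
    intro t
    rw [hset, hMu _ prob_le_one]
  have hle : ∀ t, P {x | g' x ≤ t} = P {x | g x ≤ t} := by
    intro t
    have e : ∀ k : Ω → ENNReal, {x | k x ≤ t} = {x | t < k x}ᶜ := by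
      intro k; ext x; simp
    rw [e, e, prob_compl_eq_one_sub (measurableSet_lt measurable_const hg'),
      prob_compl_eq_one_sub (measurableSet_lt measurable_const hg), hlt]
  have hmap : P.map g' = P.map g := by
    haveI := Measure.isProbabilityMeasure_map (μ := P) hg'.aemeasurable
    haveI := Measure.isProbabilityMeasure_map (μ := P) hg.aemeasurable
    apply Measure.ext_of_Iic
    intro t
    rw [Measure.map_apply hg' measurableSet_Iic, Measure.map_apply hg measurableSet_Iic]
    exact hle t
  have hint : ∫⁻ x, g' x ∂P = 1 := by
    have : ∫⁻ x, g' x ∂P = ∫⁻ x, g x ∂P := by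
      rw [← lintegral_map (f := fun y => y) measurable_id hg',
        ← lintegral_map (f := fun y => y) measurable_id hg, hmap]
    rw [this]
    have := congrArg (fun m => m Set.univ) hQg
    simpa using this
  refine ⟨P.withDensity g', ⟨by simpa using hint⟩, withDensity_absolutelyContinuous _ _, ?_, ?_⟩
  · intro c
    rw [← hle c]
    apply measure_congr
    filter_upwards [Measure.rnDeriv_withDensity P hg'] with x hx
    apply propext
    change _ ≤ c ↔ _ ≤ c
    rw [hx]
  · conv_rhs => rw [← hQg]
    apply compare_aux P g g' X Y hg hg' hX hY (Measure.rnDeriv_lt_top Q P)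
      (ae_lt_top hg' (by rw [hint]; simp))
    intro t
    obtain ⟨c, hc1, hc2⟩ := hc (P {x | t < g x}) prob_le_one
    rw [hset]
    refine (hYX _ prob_le_one).trans ?_
    exact bathtub_aux P X _ _ (measurableSet_lt hM measurable_const)
      (measurableSet_lt measurable_const hg) (hMu _ prob_le_one) c hc1 hc2

theorem stmt4
    (f : ℝ → ℝ)
    (hf_cont : ContinuousOn f (Set.Icc 0 1))
    (hf_pos : ∀ z ∈ Set.Icc (0:ℝ) 1, 0 < f z)
    (F : ℝ → ℝ) (hF : ∀ θ : ℝ, F θ = ∫ z in (0:ℝ)..θ, f z)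
    (hF1 : F 1 = 1)
    -- μF is the probability measure on [0,1] associated with the cdf F
    (μF : Measure Θ) [IsProbabilityMeasure μF]
    (hμF : ∀ c : Θ, μF {x : Θ | x ≤ c} = ENNReal.ofReal (F (c : ℝ)))
    (P : Measure (Θ × Θ)) (hP : P = μF.prod μF)
    (𝒬 : Set (Measure (Θ × Θ)))
    (hP𝒬 : P ∈ 𝒬)
    (h𝒬 : ∀ Q ∈ 𝒬, IsProbabilityMeasure Q ∧ Q ≪ P)
    -- rearrangement invariance of 𝒬
    (hinv : ∀ Q ∈ 𝒬, ∀ Q' : Measure (Θ × Θ), IsProbabilityMeasure Q' → Q' ≪ P →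
      IsRearrangement P Q Q' → Q' ∈ 𝒬)
    -- first-price and all-pay equilibrium bids
    (bI bA : ℝ → ℝ)
    (hbI : ∀ θ : ℝ, 0 < θ → bI θ = θ - (∫ z in (0:ℝ)..θ, F z) / F θ)
    (hbI0 : bI 0 = 0)
    (hbA : ∀ θ : ℝ, bA θ = θ * F θ - ∫ z in (0:ℝ)..θ, F z)
    -- first-price and all-pay transfer functions
    (tI tA : Θ → Θ → ℝ)
    (htI : ∀ θ θ' : Θ, tI θ θ' =
      bI (θ : ℝ) * ((if θ' < θ then (1:ℝ) else 0) + (if θ = θ' then 1/2 else 0)))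
    (htA : ∀ θ θ' : Θ, tA θ θ' = bA (θ : ℝ)) :
    (⨅ Q ∈ 𝒬, ∫⁻ x : Θ × Θ, ENNReal.ofReal (tA x.1 x.2 + tA x.2 x.1) ∂Q)
      ≤ ⨅ Q ∈ 𝒬, ∫⁻ x : Θ × Θ, ENNReal.ofReal (tI x.1 x.2 + tI x.2 x.1) ∂Q := by
  have hfi : ∀ a ∈ Set.Icc (0:ℝ) 1, ∀ b ∈ Set.Icc (0:ℝ) 1, IntervalIntegrable f volume a b := by
    intro a ha b hb
    apply ContinuousOn.intervalIntegrable
    exact hf_cont.mono (Set.uIcc_subset_Icc ha hb)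
  have h0m : (0:ℝ) ∈ Set.Icc (0:ℝ) 1 := by simp
  have hF0 : F 0 = 0 := by rw [hF]; simp
  have hFc : ContinuousOn F (Set.Icc 0 1) := by
    have := intervalIntegral.continuousOn_primitive_interval (μ := volume) (f := f) (a := 0) (b := 1)
      (by rw [Set.uIcc_of_le zero_le_one]; exact hf_cont.integrableOn_Icc)
    rw [Set.uIcc_of_le zero_le_one] at this
    exact this.congr fun x _ => hF x
  have hFs : StrictMonoOn F (Set.Icc 0 1) := by
    intro a ha b hb hab
    rw [hF, hF, ← sub_pos, intervalIntegral.integral_interval_sub_left (hfi _ h0m _ hb) (hfi _ h0m _ ha)]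
    apply intervalIntegral.intervalIntegral_pos_of_pos_on (hfi _ ha _ hb) _ hab
    intro x hx
    exact hf_pos x ⟨ha.1.trans hx.1.le, hx.2.le.trans hb.2⟩
  have hFnn : ∀ a ∈ Set.Icc (0:ℝ) 1, 0 ≤ F a := by
    intro a ha
    rw [← hF0]; exact hFs.monotoneOn h0m ha ha.1
  have hF1' : ∀ a ∈ Set.Icc (0:ℝ) 1, F a ≤ 1 := by
    intro a ha
    rw [← hF1]; exact hFs.monotoneOn ha (by simp) ha.2
  have hFpos : ∀ a ∈ Set.Icc (0:ℝ) 1, 0 < a → 0 < F a := by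
    intro a ha h
    rw [← hF0]; exact hFs h0m ha h
  have hFi : ∀ a ∈ Set.Icc (0:ℝ) 1, ∀ b ∈ Set.Icc (0:ℝ) 1, IntervalIntegrable F volume a b := by
    intro a ha b hb
    apply ContinuousOn.intervalIntegrable
    exact hFc.mono (Set.uIcc_subset_Icc ha hb)
  have hIb : ∀ a ∈ Set.Icc (0:ℝ) 1, ∀ b ∈ Set.Icc (0:ℝ) 1, a ≤ b →
      ∫ z in a..b, F z ≤ (b - a) * F b := by
    intro a ha b hb hab
    have : ∫ z in a..b, F z ≤ ∫ z in a..b, F b := by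
      apply intervalIntegral.integral_mono_on hab (hFi _ ha _ hb) (by simp)
      intro x hx
      exact hFs.monotoneOn ⟨ha.1.trans hx.1, hx.2.trans hb.2⟩ hb hx.2
    simpa using this
  have hInn : ∀ a ∈ Set.Icc (0:ℝ) 1, 0 ≤ ∫ z in (0:ℝ)..a, F z := by
    intro a ha
    apply intervalIntegral.integral_nonneg ha.1
    intro x hx
    exact hFnn x ⟨hx.1, hx.2.trans ha.2⟩
  have hbInn : ∀ a ∈ Set.Icc (0:ℝ) 1, 0 ≤ bI a := by
    intro a ha
    rcases ha.1.eq_or_lt with h | h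
    · rw [← h, hbI0]
    · rw [hbI a h, sub_nonneg, div_le_iff₀ (hFpos a ha h)]
      simpa using hIb 0 h0m a ha ha.1
  have hbIm : MonotoneOn bI (Set.Icc 0 1) := by
    intro a ha b hb hab
    rcases ha.1.eq_or_lt with h | h
    · rw [← h, hbI0]; exact hbInn b hb
    · rw [hbI a h, hbI b (h.trans_le hab)]
      have h1 := hIb a ha b hb hab
      have h2 := intervalIntegral.integral_add_adjacent_intervals (hFi _ h0m _ ha) (hFi _ ha _ hb)
      have hFb := hFpos b hb (h.trans_le hab)
      have hFa := hFpos a ha h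
      have h3 : (∫ z in (0:ℝ)..b, F z) / F b ≤ (∫ z in (0:ℝ)..a, F z) / F b + (b - a) := by
        rw [div_le_iff₀ hFb, add_mul, div_mul_cancel₀ _ hFb.ne']
        linarith
      have h4 : (∫ z in (0:ℝ)..a, F z) / F b ≤ (∫ z in (0:ℝ)..a, F z) / F a :=
        div_le_div_of_nonneg_left (hInn a ha) hFa (hFs.monotoneOn ha hb hab)
      linarith
  have hbAF : ∀ a ∈ Set.Icc (0:ℝ) 1, bA a = bI a * F a := by
    intro a ha
    rcases ha.1.eq_or_lt with h | h
    · rw [← h, hbI0, hbA]; simp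
    · rw [hbI a h, hbA, sub_mul, div_mul_cancel₀ _ (hFpos a ha h).ne']
  -- functions on Θ
  have hFm : Measurable fun x : Θ => F x :=
    Monotone.measurable fun x y hxy => hFs.monotoneOn x.2 y.2 hxy
  have hbImeas : Measurable fun x : Θ => bI x :=
    Monotone.measurable fun x y hxy => hbIm x.2 y.2 hxy
  have hIio : ∀ c : Θ, μF (Set.Iio c) = ENNReal.ofReal (F c) := by
    intro c
    apply le_antisymm
    · rw [← hμF]; exact measure_mono fun x (hx : x < c) => (show x ≤ c from le_of_lt hx)
    · rcases c.2.1.eq_or_lt with h | h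
      · rw [← h, hF0]; simp
      · have hlim : Filter.Tendsto (fun z => ENNReal.ofReal (F z)) (nhdsWithin (c:ℝ) (Set.Ioo 0 (c:ℝ)))
            (nhds (ENNReal.ofReal (F c))) := by
          apply ENNReal.tendsto_ofReal
          exact (hFc c c.2).mono_left (nhdsWithin_mono _ fun x hx => ⟨hx.1.le, hx.2.le.trans c.2.2⟩)
        haveI : (nhdsWithin (c:ℝ) (Set.Ioo 0 (c:ℝ))).NeBot := by
          rw [← mem_closure_iff_nhdsWithin_neBot, closure_Ioo h.ne]
          exact ⟨h.le, le_rfl⟩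
        apply le_of_tendsto hlim
        filter_upwards [self_mem_nhdsWithin] with z hz
        have := hμF ⟨z, hz.1.le, hz.2.le.trans c.2.2⟩
        simp only at this
        rw [← this]
        apply measure_mono
        intro x hx
        exact lt_of_le_of_lt hx hz.2
  haveI hPp : IsProbabilityMeasure P := by rw [hP]; infer_instance
  -- level sets
  set M : Θ × Θ → ENNReal := fun x => ENNReal.ofReal (F (max x.1 x.2 : Θ)) ^ 2 with hMdef
  have hMm : Measurable M :=
    ((hFm.comp (measurable_fst.max measurable_snd)).ennreal_ofReal).pow_const 2
  have hlev : ∀ s ≤ (1:ENNReal), ∃ a : Θ, s = ENNReal.ofReal (F a) ^ 2 ∧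
      ∀ x : Θ × Θ, M x < s ↔ x ∈ Set.Iio a ×ˢ Set.Iio a := by
    intro s hs
    have hst : s ≠ ⊤ := ne_top_of_le_ne_top ENNReal.one_ne_top hs
    have hs1 : s.toReal ≤ 1 := by
      have := ENNReal.toReal_mono ENNReal.one_ne_top hs
      simpa using this
    have : √s.toReal ∈ F '' Set.Icc 0 1 := by
      apply intermediate_value_Icc zero_le_one hFc
      rw [hF0, hF1]
      exact ⟨Real.sqrt_nonneg _, Real.sqrt_le_one.2 hs1⟩
    obtain ⟨a, ha, hFa⟩ := this
    have hsa : s = ENNReal.ofReal (F a) ^ 2 := by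
      rw [hFa, ← ENNReal.ofReal_pow (Real.sqrt_nonneg _), Real.sq_sqrt ENNReal.toReal_nonneg,
        ENNReal.ofReal_toReal hst]
    refine ⟨⟨a, ha⟩, hsa, ?_⟩
    intro x
    have hx := (max x.1 x.2).2
    rw [hsa]
    simp only [hMdef]
    rw [← ENNReal.ofReal_pow (hFnn _ hx), ← ENNReal.ofReal_pow (hFnn _ ha),
      ENNReal.ofReal_lt_ofReal_iff_of_nonneg (pow_nonneg (hFnn _ hx) 2),
      pow_lt_pow_iff_left₀ (hFnn _ hx) (hFnn _ ha) two_ne_zero, hFs.lt_iff_lt hx ha]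
    change max x.1 x.2 < ⟨a, ha⟩ ↔ _
    simp [max_lt_iff]
  have hlevs : ∀ s (a : Θ), (∀ x : Θ × Θ, M x < s ↔ x ∈ Set.Iio a ×ˢ Set.Iio a) →
      {x | M x < s} = Set.Iio a ×ˢ Set.Iio a := fun s a h => Set.ext h
  have hXeq : ∀ x : Θ × Θ, tI x.1 x.2 + tI x.2 x.1 = bI (max x.1 x.2 : Θ) := by
    rintro ⟨x, y⟩
    simp only [htI]
    rcases lt_trichotomy x y with h | h | h
    · simp [h, h.not_gt, h.ne, h.ne', max_eq_right h.le]
    · subst h; simp; ring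
    · simp [h, h.not_gt, h.ne, h.ne', max_eq_left h.le]
  have hbAm : Measurable fun x : Θ => ENNReal.ofReal (bA x) := by
    have : (fun x : Θ => ENNReal.ofReal (bA x)) = fun x : Θ => ENNReal.ofReal (bI x * F x) := by
      funext x; rw [hbAF _ x.2]
    rw [this]; exact (hbImeas.mul hFm).ennreal_ofReal
  have hYeq : ∀ x : Θ × Θ, ENNReal.ofReal (tA x.1 x.2 + tA x.2 x.1) =
      ENNReal.ofReal (bA x.1) + ENNReal.ofReal (bA x.2) := by
    intro x
    rw [htA, htA, ENNReal.ofReal_add]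
    · rw [hbAF _ x.1.2]; exact mul_nonneg (hbInn _ x.1.2) (hFnn _ x.1.2)
    · rw [hbAF _ x.2.2]; exact mul_nonneg (hbInn _ x.2.2) (hFnn _ x.2.2)
  simp only [hXeq, hYeq]
  have hXm : Measurable fun x : Θ × Θ => ENNReal.ofReal (bI (max x.1 x.2 : Θ)) :=
    (hbImeas.comp (measurable_fst.max measurable_snd)).ennreal_ofReal
  have hYm : Measurable fun x : Θ × Θ => ENNReal.ofReal (bA x.1) + ENNReal.ofReal (bA x.2) :=
    (hbAm.comp measurable_fst).add (hbAm.comp measurable_snd)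
  have hMu : ∀ s ≤ (1:ENNReal), P {x | M x < s} = s := by
    intro s hs
    obtain ⟨a, ha, h⟩ := hlev s hs
    rw [hlevs s a h, hP, Measure.prod_prod, hIio, ha, sq]
  have hc : ∀ s ≤ (1:ENNReal), ∃ c, (∀ x, M x < s → ENNReal.ofReal (bI (max x.1 x.2 : Θ)) ≤ c) ∧
      (∀ x, ¬ M x < s → c ≤ ENNReal.ofReal (bI (max x.1 x.2 : Θ))) := by
    intro s hs
    obtain ⟨a, ha, h⟩ := hlev s hs
    refine ⟨ENNReal.ofReal (bI a), ?_, ?_⟩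
    · intro x hx
      rw [h] at hx
      apply ENNReal.ofReal_le_ofReal
      apply hbIm (Subtype.property _) a.2
      exact (max_lt hx.1 hx.2).le
    · intro x hx
      rw [h] at hx
      apply ENNReal.ofReal_le_ofReal
      apply hbIm a.2 (Subtype.property _)
      by_contra hcon
      have hcon : max x.1 x.2 < a := not_le.1 hcon
      exact hx (by simpa [max_lt_iff] using hcon)
  have hYX : ∀ s ≤ (1:ENNReal),
      ∫⁻ x in {x | M x < s}, (ENNReal.ofReal (bA x.1) + ENNReal.ofReal (bA x.2)) ∂P ≤
      ∫⁻ x in {x | M x < s}, ENNReal.ofReal (bI (max x.1 x.2 : Θ)) ∂P := by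
    intro s hs
    obtain ⟨a, ha, h⟩ := hlev s hs
    rw [hlevs s a h, hP, ← Measure.prod_restrict]
    set ν := μF.restrict (Set.Iio a) with hν
    have hνle : ν Set.univ ≤ 1 := by
      rw [hν]; simpa using prob_le_one
    set J := ∫⁻ x, ENNReal.ofReal (bA x) ∂ν with hJ
    have hup : ∫⁻ x, (ENNReal.ofReal (bA x.1) + ENNReal.ofReal (bA x.2)) ∂(ν.prod ν) ≤ J + J := by
      have hb1 : Measurable fun x : Θ × Θ => ENNReal.ofReal (bA x.1) := hbAm.comp measurable_fst
      have hb2 : Measurable fun x : Θ × Θ => ENNReal.ofReal (bA x.2) := hbAm.comp measurable_snd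
      rw [lintegral_add_left hb1]
      gcongr
      · rw [lintegral_prod _ hb1.aemeasurable]
        simp only [lintegral_const]
        apply lintegral_mono
        intro x
        exact mul_le_of_le_one_right' hνle
      · rw [lintegral_prod _ hb2.aemeasurable]
        simp only [lintegral_const]
        exact mul_le_of_le_one_right' hνle
    have hinner : ∀ x : Θ, x < a →
        ∫⁻ y, (Set.Iio x).indicator (fun _ => ENNReal.ofReal (bI x)) y ∂ν =
          ENNReal.ofReal (bA x) := by
      intro x hx
      rw [lintegral_indicator measurableSet_Iio, lintegral_const, hν,
        Measure.restrict_restrict measurableSet_Iio, Measure.restrict_apply_univ,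
        Set.Iio_inter_Iio, inf_eq_left.2 hx.le, hIio, hbAF _ x.2,
        ENNReal.ofReal_mul (hbInn _ x.2)]
    have hJ' : ∫⁻ x, ∫⁻ y, (Set.Iio x).indicator (fun _ => ENNReal.ofReal (bI x)) y ∂ν ∂ν = J := by
      apply lintegral_congr_ae
      filter_upwards [ae_restrict_mem (μ := μF) (measurableSet_Iio (a := a))] with x hx
      exact hinner x hx
    have hm1 : Measurable fun x : Θ × Θ =>
        (Set.Iio x.1).indicator (fun _ => ENNReal.ofReal (bI x.1)) x.2 := by
      have : (fun x : Θ × Θ =>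
        (Set.Iio x.1).indicator (fun _ => ENNReal.ofReal (bI x.1)) x.2) =
        {x : Θ × Θ | x.2 < x.1}.indicator (fun x => ENNReal.ofReal (bI x.1)) := by
        funext x; simp [Set.indicator_apply]
      rw [this]
      exact ((hbImeas.comp measurable_fst).ennreal_ofReal).indicator
        (measurableSet_lt measurable_snd measurable_fst)
    have hm2 : Measurable fun x : Θ × Θ =>
        (Set.Iio x.2).indicator (fun _ => ENNReal.ofReal (bI x.2)) x.1 := hm1.comp measurable_swap
    have hlow : J + J ≤ ∫⁻ x, ENNReal.ofReal (bI (max x.1 x.2 : Θ)) ∂(ν.prod ν) := by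
      calc J + J = ∫⁻ x, ((Set.Iio x.1).indicator (fun _ => ENNReal.ofReal (bI x.1)) x.2 +
            (Set.Iio x.2).indicator (fun _ => ENNReal.ofReal (bI x.2)) x.1) ∂(ν.prod ν) := by
            rw [lintegral_add_left hm1, lintegral_prod _ hm1.aemeasurable,
              lintegral_prod_symm _ hm2.aemeasurable]
            simp only [hJ']
        _ ≤ _ := by
            apply lintegral_mono
            rintro ⟨x, y⟩
            rcases lt_trichotomy x y with h | h | h
            · simp [Set.indicator_apply, h, h.not_gt, max_eq_right h.le]
            · subst h; simp
            · simp [Set.indicator_apply, h, h.not_gt, max_eq_left h.le]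
    exact hup.trans hlow
  refine le_iInf₂ fun Q hQ => ?_
  obtain ⟨hQp, hQP⟩ := h𝒬 Q hQ
  obtain ⟨Q', h1, h2, h3, h4⟩ := core_aux P M _ _ hMm hXm hYm hMu hc hYX Q hQP
  exact (iInf₂_le Q' (hinv Q hQ Q' h1 h2 h3)).trans h4

end
end

section
/- Let f : [0,1] → (0,∞) be a continuous probability density with cdf F(θ) = ∫₀^θ f(z) dz, F(1) = 1 and F(θ) < 1 for θ < 1, let μ_F be the associated probability measure on [0,1], and let P = μ_F ⊗ μ_F on Θ² = [0,1]×[0,1]. Let 𝒬 be a set of probability measures on Θ², each absolutely continuous with respect to P, that is rearrangement invariant and contains P. Then the worst-case revenue of the all-pay auction is at least that of the war of attrition: inf_{Q ∈ 𝒬} ∬ [t^A₁(θ,θ') + t^A₂(θ',θ)] dQ ≥ inf_{Q ∈ 𝒬} ∬ [t^W₁(θ,θ') + t^W₂(θ',θ)] dQ (integrals valued in [0,∞]). -/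
open MeasureTheory

noncomputable section

open Set

theorem aux_core {Ω : Type*} [MeasurableSpace Ω] (μ : Measure Ω) [IsProbabilityMeasure μ]
    (ψ : Ω → UnitAddCircle) (φ : UnitAddCircle → Ω)
    (hψ : MeasurePreserving ψ μ volume) (hφ : MeasurePreserving φ volume μ)
    (q W : Ω × Ω → ENNReal) (hq : Measurable q) (hW : Measurable W) :
    ∫⁻ s : UnitAddCircle, ∫⁻ x, q (x.1, φ (s + ψ x.2)) * W x ∂(μ.prod μ)
      = ∫⁻ x, q x * (∫⁻ y, W (x.1, y) ∂μ) ∂(μ.prod μ) := by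
  have h1 := hψ.measurable
  have h2 := hφ.measurable
  have hin : ∀ x : Ω × Ω, ∫⁻ s : UnitAddCircle, q (x.1, φ (s + ψ x.2)) * W x
      = (∫⁻ y, q (x.1, y) ∂μ) * W x := by
    intro x
    rw [lintegral_mul_const _ (by fun_prop)]
    congr 1
    exact (hφ.comp (measurePreserving_add_right volume (ψ x.2))).lintegral_comp
      (f := fun y => q (x.1, y)) (by fun_prop)
  rw [lintegral_lintegral_swap (by fun_prop)]
  simp_rw [hin]
  have m1 : Measurable fun a => ∫⁻ y, q (a, y) ∂μ := hq.lintegral_prod_right'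
  have m2 : Measurable fun a => ∫⁻ y, W (a, y) ∂μ := hW.lintegral_prod_right'
  rw [lintegral_prod _ (by fun_prop), lintegral_prod _ (by fun_prop)]
  apply lintegral_congr
  intro a
  simp only
  rw [lintegral_const_mul _ (by fun_prop), lintegral_mul_const _ (by fun_prop)]

theorem aux_rearr {Ω : Type*} [MeasurableSpace Ω] (P Q : Measure Ω) [IsProbabilityMeasure P]
    [IsProbabilityMeasure Q] (hQ : Q ≪ P) (T : Ω → Ω) (hT : MeasurePreserving T P P) :
    IsProbabilityMeasure (P.withDensity (fun x => Q.rnDeriv P (T x))) ∧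
    IsRearrangement P Q (P.withDensity (fun x => Q.rnDeriv P (T x))) := by
  have hm : Measurable (Q.rnDeriv P) := Measure.measurable_rnDeriv Q P
  have hTm := hT.measurable
  constructor
  · constructor
    rw [withDensity_apply _ MeasurableSet.univ, Measure.restrict_univ, hT.lintegral_comp hm,
      Measure.lintegral_rnDeriv hQ, measure_univ]
  · intro c
    have := Measure.rnDeriv_withDensity P (hm.comp hTm)
    have h2 : P {ω | (P.withDensity (Q.rnDeriv P ∘ T)).rnDeriv P ω ≤ c}
        = P (T ⁻¹' {ω | Q.rnDeriv P ω ≤ c}) := by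
      apply measure_congr
      rw [Filter.eventuallyEq_set]
      filter_upwards [this] with x hx
      rw [mem_preimage, mem_ofPred_eq, hx, Function.comp]
    rw [hT.measure_preimage (measurableSet_le hm measurable_const).nullMeasurableSet] at h2
    exact h2

theorem aux_F (f : ℝ → ℝ)
    (hf_cont : ContinuousOn f (Set.Icc 0 1))
    (hf_pos : ∀ z ∈ Set.Icc (0:ℝ) 1, 0 < f z)
    (F : ℝ → ℝ) (hF : ∀ θ : ℝ, F θ = ∫ z in (0:ℝ)..θ, f z) :
    F 0 = 0 ∧ StrictMonoOn F (Icc 0 1) ∧ ∀ x ∈ Icc (0:ℝ) 1, HasDerivWithinAt F (f x) (Icc 0 1) x := by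
  refine ⟨by simp [hF], ?_, ?_⟩
  · intro a ha b hb hab
    have hi : ∀ c d, c ∈ Icc (0:ℝ) 1 → d ∈ Icc (0:ℝ) 1 → IntervalIntegrable f volume c d := by
      intro c d hc hd
      exact (hf_cont.mono (uIcc_subset_Icc hc hd)).intervalIntegrable
    have h := intervalIntegral.intervalIntegral_pos_of_pos_on (hi a b ha hb)
      (fun x hx => hf_pos x ⟨ha.1.trans hx.1.le, hx.2.le.trans hb.2⟩) hab
    have := intervalIntegral.integral_add_adjacent_intervals (hi 0 a (by simp) ha) (hi a b ha hb)
    rw [hF, hF]; linarith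
  · intro x hx
    have hg : Continuous (IccExtend (zero_le_one' ℝ) (domRestrict (Icc 0 1) f)) :=
      (continuousOn_iff_continuous_domRestrict.1 hf_cont).Icc_extend'
    have heq : ∀ y ∈ Icc (0:ℝ) 1, IccExtend (zero_le_one' ℝ) (domRestrict (Icc 0 1) f) y = f y := by
      intro y hy
      rw [IccExtend_of_mem _ _ hy]; rfl
    have hd := (hg.integral_hasStrictDerivAt 0 x).hasDerivAt
    rw [heq x hx] at hd
    refine hd.hasDerivWithinAt.congr_of_mem ?_ hx
    intro y hy
    rw [hF]
    apply intervalIntegral.integral_congr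
    intro z hz
    exact (heq z (uIcc_subset_Icc (by simp) hy hz)).symm

theorem aux_transport (F : ℝ → ℝ) (hF0 : F 0 = 0) (hF1 : F 1 = 1)
    (hmono : StrictMonoOn F (Icc 0 1)) (hcont : ContinuousOn F (Icc 0 1))
    (μF : Measure Θ) [IsProbabilityMeasure μF]
    (hμF : ∀ c : Θ, μF {x : Θ | x ≤ c} = ENNReal.ofReal (F (c : ℝ))) :
    ∃ (ψ : Θ → UnitAddCircle) (φ : UnitAddCircle → Θ),
      MeasurePreserving ψ μF volume ∧ MeasurePreserving φ volume μF := by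
  let H : Θ → ℝ := fun x => F x
  have hHc : Continuous H := continuousOn_iff_continuous_domRestrict.1 hcont
  have hHm : StrictMono H := fun a b hab => hmono a.2 b.2 hab
  have hH01 : ∀ x, H x ∈ Icc (0:ℝ) 1 := by
    intro x
    constructor
    · rw [← hF0]; exact hmono.monotoneOn (by simp) x.2 x.2.1
    · rw [← hF1]; exact hmono.monotoneOn x.2 (by simp) x.2.2
  have hmap : MeasurePreserving H μF (volume.restrict (Ioc (0:ℝ) (0+1))) := by
    refine ⟨hHc.measurable, ?_⟩
    have := Measure.isProbabilityMeasure_map (μ := μF) hHc.measurable.aemeasurable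
    apply Measure.ext_of_Iic
    intro d
    rw [Measure.map_apply hHc.measurable measurableSet_Iic, Measure.restrict_apply measurableSet_Iic]
    rcases lt_or_ge d 0 with hd | hd
    · have e1 : H ⁻¹' Iic d = ∅ := by
        ext x; simp only [mem_preimage, mem_Iic, mem_empty_iff_false, iff_false]
        have := (hH01 x).1; linarith
      have e2 : Iic d ∩ Ioc (0:ℝ) (0+1) = ∅ := by
        ext x; simp only [mem_inter_iff, mem_Iic, mem_Ioc, mem_empty_iff_false, iff_false]
        rintro ⟨h1, h2, h3⟩; linarith
      rw [e1, e2]; simp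
    rcases le_or_gt d 1 with hd1 | hd1
    · obtain ⟨c, hc, hcd⟩ : d ∈ F '' Icc 0 1 := by
        apply intermediate_value_Icc zero_le_one hcont
        rw [hF0, hF1]; exact ⟨hd, hd1⟩
      have e1 : H ⁻¹' Iic d = {x : Θ | x ≤ ⟨c, hc⟩} := by
        ext x
        simp only [mem_preimage, mem_Iic, mem_ofPred_eq]
        rw [← hHm.le_iff_le, ← hcd]
      have e2 : Iic d ∩ Ioc (0:ℝ) (0+1) = Ioc 0 d := by
        ext x; simp only [mem_inter_iff, mem_Iic, mem_Ioc]
        constructor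
        · rintro ⟨h1, h2, h3⟩; exact ⟨h2, h1⟩
        · rintro ⟨h1, h2⟩; exact ⟨h2, h1, by linarith⟩
      rw [e1, e2, hμF, hcd]; simp
    · have e1 : H ⁻¹' Iic d = univ := by
        ext x; simp only [mem_preimage, mem_Iic, mem_univ, iff_true]
        have := (hH01 x).2; linarith
      have e2 : Iic d ∩ Ioc (0:ℝ) (0+1) = Ioc 0 1 := by
        ext x; simp only [mem_inter_iff, mem_Iic, mem_Ioc]
        constructor
        · rintro ⟨h1, h2, h3⟩; exact ⟨h2, by linarith⟩
        · rintro ⟨h1, h2⟩; exact ⟨by linarith, h1, by linarith⟩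
      rw [e1, e2]; simp
  have hemb : MeasurableEmbedding H := (hHc.isClosedEmbedding hHm.injective).measurableEmbedding
  obtain ⟨K, hK, hKH⟩ := hemb.exists_measurable_extend (g := id) measurable_id
    (fun _ => ⟨⟨0, by simp⟩⟩)
  have hKmp : MeasurePreserving K (volume.restrict (Ioc (0:ℝ) (0+1))) μF := by
    refine ⟨hK, ?_⟩
    rw [← hmap.map_eq, Measure.map_map hK hHc.measurable, hKH, Measure.map_id]
  have hv : MeasurePreserving (Subtype.val : Ioc (0:ℝ) (0+1) → ℝ) (Measure.comap Subtype.val volume)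
      (volume.restrict (Ioc (0:ℝ) (0+1))) :=
    ⟨measurable_subtype_coe, map_comap_subtype_coe measurableSet_Ioc _⟩
  have h1 := (UnitAddCircle.measurePreserving_mk 0).comp hmap
  have h2 := (hKmp.comp hv).comp (AddCircle.measurePreserving_equivIoc 1 (a := 0))
  exact ⟨_, _, h1, h2⟩

theorem aux_bA (f : ℝ → ℝ)
    (hf_cont : ContinuousOn f (Set.Icc 0 1))
    (hf_pos : ∀ z ∈ Set.Icc (0:ℝ) 1, 0 < f z)
    (F : ℝ → ℝ) 
    (hd : ∀ x ∈ Icc (0:ℝ) 1, HasDerivWithinAt F (f x) (Icc 0 1) x)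
    (θ : ℝ) (hθ : θ ∈ Icc (0:ℝ) 1) :
    0 ≤ θ * F θ - ∫ z in (0:ℝ)..θ, F z ∧
    ENNReal.ofReal (θ * F θ - ∫ z in (0:ℝ)..θ, F z)
      = ∫⁻ z in Ioo 0 θ, ENNReal.ofReal (z * f z) := by
  have hs : uIcc 0 θ ⊆ Icc 0 1 := uIcc_subset_Icc (by simp) hθ
  have hs' : Ioc 0 θ ⊆ Icc 0 1 := fun x hx => ⟨hx.1.le, hx.2.trans hθ.2⟩
  have hfi : IntervalIntegrable f volume 0 θ := (hf_cont.mono hs).intervalIntegrable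
  have hp := intervalIntegral.integral_mul_deriv_eq_deriv_mul_of_hasDerivWithinAt
    (u := fun x => x) (u' := fun _ => (1:ℝ)) (v := F) (v' := f) (a := 0) (b := θ)
    (fun x _ => (hasDerivAt_id x).hasDerivWithinAt) (fun x hx => (hd x (hs hx)).mono hs)
    (by simp) hfi
  simp only [one_mul, zero_mul, sub_zero] at hp
  rw [← hp]
  have hc : ContinuousOn (fun z => z * f z) (uIcc 0 θ) := continuousOn_id.mul (hf_cont.mono hs)
  have hpos : ∀ z ∈ Ioc 0 θ, 0 ≤ z * f z := fun z hz => mul_nonneg hz.1.le (hf_pos z (hs' hz)).le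
  rw [intervalIntegral.integral_of_le hθ.1]
  refine ⟨setIntegral_nonneg measurableSet_Ioc hpos, ?_⟩
  rw [ofReal_integral_eq_lintegral_ofReal, setLIntegral_congr Ioo_ae_eq_Ioc]
  · exact (intervalIntegrable_iff_integrableOn_Ioc_of_le hθ.1).1 hc.intervalIntegrable
  · exact (ae_restrict_iff' measurableSet_Ioc).2 (ae_of_all _ hpos)

/-- the lower-integral version of the war-of-attrition bid -/
def auxw (f F : ℝ → ℝ) (θ : ℝ) : ENNReal :=
  ∫⁻ z in Ioo 0 θ, ENNReal.ofReal (z * f z / (1 - F z))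

theorem auxw_mono (f F : ℝ → ℝ) : Monotone (auxw f F) := by
  intro a b hab
  exact lintegral_mono_set (Ioo_subset_Ioo_right hab)

theorem aux_bW (f : ℝ → ℝ)
    (hf_cont : ContinuousOn f (Set.Icc 0 1))
    (hf_pos : ∀ z ∈ Set.Icc (0:ℝ) 1, 0 < f z)
    (F : ℝ → ℝ) (hcont : ContinuousOn F (Icc 0 1))
    (hFlt : ∀ θ : ℝ, 0 ≤ θ → θ < 1 → F θ < 1)
    (θ : ℝ) (hθ : θ ∈ Ico (0:ℝ) 1) :
    ENNReal.ofReal (∫ z in (0:ℝ)..θ, z * f z / (1 - F z)) = auxw f F θ := by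
  have hs : uIcc 0 θ ⊆ Icc 0 1 := uIcc_subset_Icc (by simp) ⟨hθ.1, hθ.2.le⟩
  have hs' : Ioc 0 θ ⊆ Icc 0 1 := fun x hx => ⟨hx.1.le, hx.2.trans hθ.2.le⟩
  have hc : ContinuousOn (fun z => z * f z / (1 - F z)) (uIcc 0 θ) := by
    apply ContinuousOn.div (continuousOn_id.mul (hf_cont.mono hs))
      (continuousOn_const.sub (hcont.mono hs))
    intro x hx
    rw [uIcc_of_le hθ.1] at hx
    have := hFlt x hx.1 (hx.2.trans_lt hθ.2)
    show 1 - F x ≠ 0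
    linarith
  have hpos : ∀ z ∈ Ioc 0 θ, 0 ≤ z * f z / (1 - F z) := fun z hz =>
    div_nonneg (mul_nonneg hz.1.le (hf_pos z (hs' hz)).le)
      (by have := hFlt z hz.1.le (hz.2.trans_lt hθ.2); linarith)
  rw [intervalIntegral.integral_of_le hθ.1, auxw]
  rw [ofReal_integral_eq_lintegral_ofReal, setLIntegral_congr Ioo_ae_eq_Ioc]
  · exact (intervalIntegrable_iff_integrableOn_Ioc_of_le hθ.1).1 hc.intervalIntegrable
  · exact (ae_restrict_iff' measurableSet_Ioc).2 (ae_of_all _ hpos)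

theorem aux_interim (f : ℝ → ℝ)
    (hf_cont : ContinuousOn f (Set.Icc 0 1))
    (F : ℝ → ℝ) (hcont : ContinuousOn F (Icc 0 1))
    (hFlt : ∀ θ : ℝ, 0 ≤ θ → θ < 1 → F θ < 1) (hF0 : ∀ θ ∈ Icc (0:ℝ) 1, 0 ≤ F θ)
    (μF : Measure Θ) [IsProbabilityMeasure μF]
    (hμF : ∀ c : Θ, μF {x : Θ | x ≤ c} = ENNReal.ofReal (F (c : ℝ)))
    (θ : ℝ) (hθ : θ ∈ Icc (0:ℝ) 1) :
    ∫⁻ y : Θ, auxw f F (min θ (y:ℝ)) ∂μF = ∫⁻ z in Ioo 0 θ, ENNReal.ofReal (z * f z) := by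
  have hs : Ioo 0 θ ⊆ Icc 0 1 := fun x hx => ⟨hx.1.le, hx.2.le.trans hθ.2⟩
  have hfm : AEMeasurable f (volume.restrict (Ioo 0 θ)) :=
    (hf_cont.mono hs).aemeasurable measurableSet_Ioo
  have hFm : AEMeasurable F (volume.restrict (Ioo 0 θ)) :=
    (hcont.mono hs).aemeasurable measurableSet_Ioo
  have hhm : AEMeasurable (fun z => ENNReal.ofReal (z * f z / (1 - F z)))
      (volume.restrict (Ioo 0 θ)) := by fun_prop
  have e : ∀ y : Θ, auxw f F (min θ (y:ℝ)) = ∫⁻ z in Ioo 0 θ,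
      ENNReal.ofReal (z * f z / (1 - F z)) * ({p : Θ × ℝ | p.2 < (p.1:ℝ)}.indicator 1 (y, z)) := by
    intro y
    have : Ioo 0 (min θ (y:ℝ)) = Iio (y:ℝ) ∩ Ioo 0 θ := by
      ext x; simp only [mem_Ioo, mem_inter_iff, mem_Iio, lt_min_iff]; tauto
    rw [auxw, this, ← Measure.restrict_restrict measurableSet_Iio,
      ← lintegral_indicator measurableSet_Iio]
    apply lintegral_congr
    intro z
    by_cases h : z < (y:ℝ) <;> simp [indicator, h]
  simp_rw [e]
  have hset : MeasurableSet {p : Θ × ℝ | p.2 < (p.1:ℝ)} :=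
    measurableSet_lt (by fun_prop) (by fun_prop)
  rw [lintegral_lintegral_swap]
  · apply setLIntegral_congr_fun measurableSet_Ioo
    intro z hz
    have hz1 := hs hz
    have hlt := hFlt z hz1.1 (hz.2.trans_le hθ.2)
    simp only
    have hmi : Measurable fun y : Θ =>
        ({p : Θ × ℝ | p.2 < (p.1:ℝ)}.indicator 1 (y, z) : ENNReal) :=
      (measurable_one.indicator hset).comp (measurable_id.prodMk measurable_const)
    rw [lintegral_const_mul _ hmi]
    have : ∫⁻ y : Θ, {p : Θ × ℝ | p.2 < (p.1:ℝ)}.indicator 1 (y, z) ∂μF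
        = ENNReal.ofReal (1 - F z) := by
      have e1 : ∀ y : Θ, ({p : Θ × ℝ | p.2 < (p.1:ℝ)}.indicator 1 (y, z) : ENNReal)
          = ({x : Θ | x ≤ ⟨z, hz1⟩}ᶜ).indicator 1 y := by
        intro y
        simp only [indicator, mem_ofPred_eq, mem_compl_iff, not_le, ← Subtype.coe_lt_coe, Pi.one_apply]
      simp_rw [e1]
      have hm : MeasurableSet {x : Θ | x ≤ ⟨z, hz1⟩} := measurableSet_Iic
      rw [lintegral_indicator_one hm.compl, prob_compl_eq_one_sub hm, hμF,
        ENNReal.ofReal_sub _ (hF0 z hz1), ENNReal.ofReal_one]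
    rw [this, ← ENNReal.ofReal_mul' (by linarith)]
    congr 1
    have : 1 - F z ≠ 0 := by linarith
    field_simp
  · apply AEMeasurable.mul
    · exact hhm.comp_snd
    · exact (measurable_one.indicator hset).aemeasurable

theorem stmt5
    (f : ℝ → ℝ)
    (hf_cont : ContinuousOn f (Set.Icc 0 1))
    (hf_pos : ∀ z ∈ Set.Icc (0:ℝ) 1, 0 < f z)
    (F : ℝ → ℝ) (hF : ∀ θ : ℝ, F θ = ∫ z in (0:ℝ)..θ, f z)
    (hF1 : F 1 = 1)
    (hFlt : ∀ θ : ℝ, 0 ≤ θ → θ < 1 → F θ < 1)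
    -- μF is the probability measure on [0,1] associated with the cdf F
    (μF : Measure Θ) [IsProbabilityMeasure μF]
    (hμF : ∀ c : Θ, μF {x : Θ | x ≤ c} = ENNReal.ofReal (F (c : ℝ)))
    (P : Measure (Θ × Θ)) (hP : P = μF.prod μF)
    (𝒬 : Set (Measure (Θ × Θ)))
    (hP𝒬 : P ∈ 𝒬)
    (h𝒬 : ∀ Q ∈ 𝒬, IsProbabilityMeasure Q ∧ Q ≪ P)
    -- rearrangement invariance of 𝒬
    (hinv : ∀ Q ∈ 𝒬, ∀ Q' : Measure (Θ × Θ), IsProbabilityMeasure Q' → Q' ≪ P →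
      IsRearrangement P Q Q' → Q' ∈ 𝒬)
    -- all-pay and war-of-attrition equilibrium bids
    (bA bW : ℝ → ℝ)
    (hbA : ∀ θ : ℝ, bA θ = θ * F θ - ∫ z in (0:ℝ)..θ, F z)
    (hbW : ∀ θ : ℝ, bW θ = ∫ z in (0:ℝ)..θ, z * f z / (1 - F z))
    -- all-pay and war-of-attrition transfer functions
    (tA tW : Θ → Θ → ℝ)
    (htA : ∀ θ θ' : Θ, tA θ θ' = bA (θ : ℝ))
    (htW : ∀ θ θ' : Θ, tW θ θ' = if θ' < θ then bW (θ' : ℝ) else bW (θ : ℝ)) :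
    (⨅ Q ∈ 𝒬, ∫⁻ x : Θ × Θ, ENNReal.ofReal (tW x.1 x.2 + tW x.2 x.1) ∂Q)
      ≤ ⨅ Q ∈ 𝒬, ∫⁻ x : Θ × Θ, ENNReal.ofReal (tA x.1 x.2 + tA x.2 x.1) ∂Q := by
  obtain ⟨hF0, hmono, hd⟩ := aux_F f hf_cont hf_pos F hF
  have hcont : ContinuousOn F (Icc 0 1) := fun x hx => (hd x hx).continuousWithinAt
  have hFnn : ∀ θ ∈ Icc (0:ℝ) 1, 0 ≤ F θ := by
    intro θ hθ
    rw [← hF0]; exact hmono.monotoneOn (by simp) hθ hθ.1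
  obtain ⟨ψ, φ, hψ, hφ⟩ := aux_transport F hF0 hF1 hmono hcont μF hμF
  have hPp : IsProbabilityMeasure P := by rw [hP]; infer_instance
  -- the point 1 is null
  have hnull : ∀ᵐ x : Θ ∂μF, (x : ℝ) < 1 := by
    have hz : μF {(⟨1, by simp⟩ : Θ)} = 0 := by
      have hsing : ∀ u : UnitAddCircle, (volume : Measure UnitAddCircle) {u} = 0 := by
        intro u
        rw [← Metric.closedBall_zero, AddCircle.volume_closedBall]; simp
      refine measure_mono_null (t := ψ ⁻¹' {ψ ⟨1, by simp⟩}) (by simp) ?_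
      rw [hψ.measure_preimage (measurableSet_singleton _).nullMeasurableSet]
      exact hsing _
    filter_upwards [measure_eq_zero_iff_ae_notMem.1 hz] with x hx
    refine lt_of_le_of_ne x.2.2 ?_
    intro h
    exact hx (Subtype.ext h)
  let W : Θ × Θ → ENNReal := fun x => 2 * auxw f F (min (x.1:ℝ) (x.2:ℝ))
  have hwm : Measurable (auxw f F) := (auxw_mono f F).measurable
  have hW : Measurable W := by
    show Measurable fun x : Θ × Θ => 2 * auxw f F (min (x.1:ℝ) (x.2:ℝ))
    fun_prop
  have hWe : ∀ᵐ x ∂P, ENNReal.ofReal (tW x.1 x.2 + tW x.2 x.1) = W x := by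
    rw [hP]
    filter_upwards [Measure.quasiMeasurePreserving_fst.ae hnull,
      Measure.quasiMeasurePreserving_snd.ae hnull] with x h1 h2
    have : tW x.1 x.2 + tW x.2 x.1 = 2 * bW (min (x.1:ℝ) (x.2:ℝ)) := by
      rw [htW, htW]
      rcases lt_trichotomy x.1 x.2 with h | h | h
      · have h' : (x.1:ℝ) ≤ x.2 := h.le
        rw [if_pos h, if_neg h.not_gt, min_eq_left h']; ring
      · rw [h]; simp; ring
      · have h' : (x.2:ℝ) ≤ x.1 := h.le
        rw [if_pos h, if_neg h.not_gt, min_eq_right h']; ring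
    rw [this, ENNReal.ofReal_mul (by norm_num), hbW,
      aux_bW f hf_cont hf_pos F hcont hFlt _ ⟨le_min x.1.2.1 x.2.2.1, min_lt_of_left_lt h1⟩]
    simp [W]
  let a : Θ → ENNReal := fun x => ENNReal.ofReal (bA x)
  have ha : ∀ x : Θ, ∫⁻ y, W (x, y) ∂μF = 2 * a x := by
    intro x
    have := aux_interim f hf_cont F hcont hFlt hFnn μF hμF x x.2
    show ∫⁻ y : Θ, 2 * auxw f F (min (x:ℝ) (y:ℝ)) ∂μF = _
    rw [lintegral_const_mul _ (by fun_prop), this,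
      ← (aux_bA f hf_cont hf_pos F hd x x.2).2, ← hbA]
  have ham : Measurable a := by
    have h1 : Measurable fun x : Θ => ∫⁻ y, W (x, y) ∂μF := hW.lintegral_prod_right'
    have : a = fun x => 2⁻¹ * ∫⁻ y, W (x, y) ∂μF := by
      funext x
      rw [ha, ← mul_assoc, ENNReal.inv_mul_cancel (by simp) (by simp), one_mul]
    rw [this]; fun_prop
  refine le_iInf₂ fun Q hQ => ?_
  obtain ⟨hQp, hQP⟩ := h𝒬 Q hQ
  set I := (⨅ Q ∈ 𝒬, ∫⁻ x : Θ × Θ, ENNReal.ofReal (tW x.1 x.2 + tW x.2 x.1) ∂Q) with hI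
  have hqm : Measurable (Q.rnDeriv P) := Measure.measurable_rnDeriv Q P
  have hLD : Q.HaveLebesgueDecomposition P :=
    Measure.haveLebesgueDecomposition_of_sigmaFinite Q P
  have hT : ∀ T : Θ × Θ → Θ × Θ, MeasurePreserving T P P →
      I ≤ ∫⁻ x, Q.rnDeriv P (T x) * W x ∂P := by
    intro T hT
    obtain ⟨h1, h2⟩ := aux_rearr P Q hQP T hT
    have hac := withDensity_absolutelyContinuous P (fun x => Q.rnDeriv P (T x))
    refine (iInf₂_le _ (hinv Q hQ _ h1 hac h2)).trans ?_
    rw [lintegral_congr_ae (hac.ae_le hWe)]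
    exact lintegral_withDensity_le_lintegral_mul P (hqm.comp hT.measurable) W
  have hTs : ∀ s : UnitAddCircle,
      MeasurePreserving (fun x : Θ × Θ => (x.1, φ (s + ψ x.2))) P P := by
    intro s
    rw [hP]
    exact (MeasurePreserving.id μF).prod
      ((hφ.comp (measurePreserving_add_left volume s)).comp hψ)
  have hsw : MeasurePreserving (Prod.swap : Θ × Θ → Θ × Θ) P P := by
    rw [hP]; exact Measure.measurePreserving_swap
  have hcst : I = ∫⁻ s : UnitAddCircle, I := by simp
  have k1 : I ≤ 2 * ∫⁻ x, a x.1 ∂Q := by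
    calc I = ∫⁻ s : UnitAddCircle, I := hcst
      _ ≤ ∫⁻ s : UnitAddCircle, ∫⁻ x, Q.rnDeriv P (x.1, φ (s + ψ x.2)) * W x ∂P :=
        lintegral_mono fun s => hT _ (hTs s)
      _ = ∫⁻ x, Q.rnDeriv P x * (2 * a x.1) ∂P := by
        have := aux_core μF ψ φ hψ hφ (Q.rnDeriv P) W hqm hW
        rw [← hP] at this
        rw [this]; simp_rw [ha]
      _ = 2 * ∫⁻ x, a x.1 ∂Q := by
        rw [← lintegral_const_mul _ (by fun_prop), lintegral_rnDeriv_mul hQP (by fun_prop)]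
  have k2 : I ≤ 2 * ∫⁻ x, a x.2 ∂Q := by
    calc I = ∫⁻ s : UnitAddCircle, I := hcst
      _ ≤ ∫⁻ s : UnitAddCircle, ∫⁻ x, (Q.rnDeriv P ∘ Prod.swap) (x.1, φ (s + ψ x.2)) * W x ∂P :=
        lintegral_mono fun s => hT _ (hsw.comp (hTs s))
      _ = ∫⁻ x, (Q.rnDeriv P) (Prod.swap x) * (2 * a (Prod.swap x).2) ∂P := by
        have := aux_core μF ψ φ hψ hφ (Q.rnDeriv P ∘ Prod.swap) W (hqm.comp measurable_swap) hW
        rw [← hP] at this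
        rw [this]; simp_rw [ha]; rfl
      _ = ∫⁻ x, Q.rnDeriv P x * (2 * a x.2) ∂P :=
        hsw.lintegral_comp (f := fun x => Q.rnDeriv P x * (2 * a x.2)) (by fun_prop)
      _ = 2 * ∫⁻ x, a x.2 ∂Q := by
        rw [← lintegral_const_mul _ (by fun_prop), lintegral_rnDeriv_mul hQP (by fun_prop)]
  have hA : ∫⁻ x : Θ × Θ, ENNReal.ofReal (tA x.1 x.2 + tA x.2 x.1) ∂Q
      = ∫⁻ x, a x.1 ∂Q + ∫⁻ x, a x.2 ∂Q := by
    rw [← lintegral_add_left (by fun_prop)]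
    apply lintegral_congr
    intro x
    have p : ∀ y : Θ, 0 ≤ bA y := fun y => by
      rw [hbA]; exact (aux_bA f hf_cont hf_pos F hd y y.2).1
    rw [htA, htA, ENNReal.ofReal_add (p _) (p _)]
  rw [hA]
  rcases le_total (∫⁻ x, a x.1 ∂Q) (∫⁻ x, a x.2 ∂Q) with h | h
  · refine k1.trans ?_
    rw [two_mul]; gcongr
  · refine k2.trans ?_
    rw [two_mul]; gcongr

end
end

section
/- Let f : [0,1] → (0,∞) be a continuous probability density with cdf F(θ) = ∫₀^θ f(z) dz, F(1) = 1 and F(θ) < 1 for θ < 1, and assume θ ↦ θ·f(θ)/(1−F(θ)) is nondecreasing on (0,1). Let μ_F be the associated probability measure on [0,1] and P = μ_F ⊗ μ_F on Θ² = [0,1]×[0,1]. Let 𝒬 be a set of probability measures on Θ², each absolutely continuous with respect to P, that is rearrangement invariant and contains P. Then the worst-case revenue of the second-price auction is at least that of the war of attrition: inf_{Q ∈ 𝒬} ∬ [t^{II}₁(θ,θ') + t^{II}₂(θ',θ)] dQ ≥ inf_{Q ∈ 𝒬} ∬ [t^W₁(θ,θ') + t^W₂(θ',θ)] dQ (integrals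 valued in [0,∞]). -/
open MeasureTheory

noncomputable section

/-- antitone rearrangement -/
theorem aux_rearr_s6 {Ω : Type*} [MeasurableSpace Ω] (P : Measure Ω) [IsProbabilityMeasure P]
    (M : Ω → Θ) (hM : Measurable M) (s : Θ → ENNReal) (hs : StrictMono s)
    (hsP : ∀ m, P {x | M x ≤ m} = s m) (hsurj : ∀ u : ENNReal, u ≤ 1 → ∃ m, s m = u)
    (q : Ω → ENNReal) (hq : Measurable q) :
    ∃ g : Θ → ENNReal, Antitone g ∧ Measure.map q P = Measure.map (fun x => g (M x)) P := by
  let g : Θ → ENNReal := fun m => sSup {c | s m ≤ P {x | c ≤ q x}}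
  have hg : Antitone g := by
    intro a b hab
    apply sSup_le_sSup
    intro c hc
    exact (hs.monotone hab).trans hc
  have hgc : ∀ m c, c ≤ g m ↔ s m ≤ P {x | c ≤ q x} := by
    intro m c
    constructor
    · intro h
      have hne : {c | s m ≤ P {x | c ≤ q x}}.Nonempty := by
        refine ⟨0, ?_⟩
        simp only [Set.mem_ofPred_eq, zero_le, Set.ofPred_true, measure_univ]
        rw [← hsP]; exact prob_le_one
      obtain ⟨u, hu, hlim, hmem⟩ := exists_seq_tendsto_sSup hne (OrderTop.bddAbove _)
      have hset : {x | g m ≤ q x} = ⋂ n, {x | u n ≤ q x} := by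
        ext x
        simp only [Set.mem_ofPred_eq, Set.mem_iInter]
        constructor
        · intro hx n
          exact (le_sSup (hmem n)).trans hx
        · intro hx
          exact le_of_tendsto' hlim hx
      have hl := tendsto_measure_iInter_atTop (μ := P) (s := fun n => {x | u n ≤ q x})
        (fun n => (measurableSet_le measurable_const hq).nullMeasurableSet)
        (fun i j hij x hx => (hu hij).trans hx) ⟨0, measure_ne_top _ _⟩
      rw [← hset] at hl
      have h1 : s m ≤ P {x | g m ≤ q x} := ge_of_tendsto' hl (fun n => hmem n)
      exact h1.trans (measure_mono fun x hx => h.trans hx)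
    · intro h
      exact le_sSup h
  refine ⟨g, hg, ?_⟩
  have hgM : Measurable (fun x => g (M x)) := hg.measurable.comp hM
  have : IsFiniteMeasure (Measure.map q P) := inferInstance
  apply Measure.ext_of_Ici
  intro c
  rw [Measure.map_apply hq measurableSet_Ici, Measure.map_apply hgM measurableSet_Ici]
  obtain ⟨mc, hmc⟩ := hsurj (P {x | c ≤ q x}) prob_le_one
  have : (fun x => g (M x)) ⁻¹' Set.Ici c = {x | M x ≤ mc} := by
    ext x
    simp only [Set.mem_preimage, Set.mem_Ici, Set.mem_ofPred_eq, hgc, ← hmc, hs.le_iff_le]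
  rw [this, hsP, hmc]
  rfl

theorem aux_bath {Ω : Type*} [MeasurableSpace Ω] (P : Measure Ω) [IsProbabilityMeasure P]
    (M : Ω → Θ) (hM : Measurable M) (q : Ω → ENNReal) (hq : Measurable q)
    (g : Θ → ENNReal) (hg : Antitone g)
    (hmap : Measure.map q P = Measure.map (fun x => g (M x)) P) (m : Θ) :
    ∫⁻ x in {x | M x ≤ m}, q x ∂P ≤ ∫⁻ x in {x | M x ≤ m}, g (M x) ∂P := by
  have hgM : Measurable (fun x => g (M x)) := hg.measurable.comp hM
  have hB : MeasurableSet {x | M x ≤ m} := measurableSet_le hM measurable_const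
  set c := g m
  have hsub : Measurable (fun y : ENNReal => y - c) := measurable_id.sub_const c
  have e : ∫⁻ x, (q x - c) ∂P = ∫⁻ x, (g (M x) - c) ∂P := by
    rw [← lintegral_map hsub hq, hmap, lintegral_map hsub hgM]
  have e2 : ∫⁻ x, (g (M x) - c) ∂P = ∫⁻ x in {x | M x ≤ m}, (g (M x) - c) ∂P := by
    rw [← lintegral_indicator hB]
    congr 1
    ext x
    by_cases h : x ∈ {x | M x ≤ m}
    · rw [Set.indicator_of_mem h]
    · rw [Set.indicator_of_notMem h]
      have : m ≤ M x := (not_le.1 h).le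
      exact tsub_eq_zero_of_le (hg this)
  calc ∫⁻ x in {x | M x ≤ m}, q x ∂P ≤ ∫⁻ x in {x | M x ≤ m}, (q x - c) + c ∂P :=
        lintegral_mono fun x => le_tsub_add
    _ = ∫⁻ x in {x | M x ≤ m}, (q x - c) ∂P + ∫⁻ x in {x | M x ≤ m}, c ∂P :=
        lintegral_add_right _ measurable_const
    _ ≤ ∫⁻ x, (q x - c) ∂P + ∫⁻ x in {x | M x ≤ m}, c ∂P := by
        gcongr; exact Measure.restrict_le_self
    _ = ∫⁻ x in {x | M x ≤ m}, (g (M x) - c) ∂P + ∫⁻ x in {x | M x ≤ m}, c ∂P := by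
        rw [e, e2]
    _ = ∫⁻ x in {x | M x ≤ m}, (g (M x) - c) + c ∂P :=
        (lintegral_add_right _ measurable_const).symm
    _ = ∫⁻ x in {x | M x ≤ m}, g (M x) ∂P := by
        apply setLIntegral_congr_fun hB
        intro x hx
        exact tsub_add_cancel_of_le (hg hx)

theorem aux_HL {Ω : Type*} [MeasurableSpace Ω] (Q Q' : Measure Ω) [IsProbabilityMeasure Q]
    [IsProbabilityMeasure Q'] (M : Ω → Θ) (hM : Measurable M)
    (h : ∀ m, Q {x | M x ≤ m} ≤ Q' {x | M x ≤ m}) :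
    ∫⁻ x, ENNReal.ofReal (M x : ℝ) ∂Q' ≤ ∫⁻ x, ENNReal.ofReal (M x : ℝ) ∂Q := by
  have hM' : Measurable (fun x => (M x : ℝ)) := measurable_subtype_coe.comp hM
  rw [lintegral_eq_lintegral_meas_lt Q' (Filter.Eventually.of_forall fun x => (M x).2.1)
    hM'.aemeasurable, lintegral_eq_lintegral_meas_lt Q
    (Filter.Eventually.of_forall fun x => (M x).2.1) hM'.aemeasurable]
  apply setLIntegral_mono' measurableSet_Ioi
  intro z hz
  by_cases h1 : z ≤ 1
  · let m : Θ := ⟨z, le_of_lt hz, h1⟩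
    have hB : MeasurableSet {x | M x ≤ m} := measurableSet_le hM measurable_const
    have : {a | z < (M a : ℝ)} = {x | M x ≤ m}ᶜ := by
      ext x
      simp only [Set.mem_ofPred_eq, Set.mem_compl_iff, not_le]
      rfl
    rw [this, prob_compl_eq_one_sub hB, prob_compl_eq_one_sub hB]
    exact tsub_le_tsub_left (h m) 1
  · have : {a | z < (M a : ℝ)} = ∅ := by
      ext x
      simp only [Set.mem_ofPred_eq, Set.mem_empty_iff_false, iff_false, not_lt]
      exact (M x).2.2.trans (not_le.1 h1).le
    simp [this]

theorem aux_cross {Ω : Type*} [MeasurableSpace Ω] (P : Measure Ω) [IsProbabilityMeasure P]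
    (M : Ω → Θ) (hM : Measurable M) (g : Θ → ENNReal) (hg : Antitone g)
    (Φ : Θ → ENNReal) (hΦ : Measurable Φ) (m0 : Θ) (hfin : g m0 ≠ ⊤)
    (h1 : ∀ m < m0, Φ m ≤ ENNReal.ofReal m) (h2 : ∀ m, m0 < m → ENNReal.ofReal m ≤ Φ m)
    (hE : ∫⁻ x, Φ (M x) ∂P ≤ ∫⁻ x, ENNReal.ofReal (M x : ℝ) ∂P) :
    ∫⁻ x, g (M x) * Φ (M x) ∂P ≤ ∫⁻ x, g (M x) * ENNReal.ofReal (M x : ℝ) ∂P := by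
  have hgM : Measurable (fun x => g (M x)) := hg.measurable.comp hM
  have hM' : Measurable (fun x => ENNReal.ofReal (M x : ℝ)) :=
    (measurable_subtype_coe.comp hM).ennreal_ofReal
  have hΦM : Measurable (fun x => Φ (M x)) := hΦ.comp hM
  set c := g m0
  have key : ∀ m : Θ, g m * Φ m + c * ENNReal.ofReal m ≤ g m * ENNReal.ofReal m + c * Φ m := by
    intro m
    rcases lt_trichotomy m m0 with h | h | h
    · have a := h1 m h
      have b : c ≤ g m := hg h.le
      obtain ⟨d, hd⟩ := exists_add_of_le a
      obtain ⟨e, he⟩ := exists_add_of_le b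
      rw [hd, he]
      exact le_of_le_of_eq (le_self_add (b := e * d)) (by ring)
    · subst h; rw [add_comm]
    · have a := h2 m h
      have b : g m ≤ c := hg h.le
      obtain ⟨d, hd⟩ := exists_add_of_le a
      obtain ⟨e, he⟩ := exists_add_of_le b
      rw [hd, he]
      exact le_of_le_of_eq (le_self_add (b := e * d)) (by ring)
  have hψ : ∫⁻ x, ENNReal.ofReal (M x : ℝ) ∂P ≠ ⊤ := by
    apply ne_top_of_le_ne_top (b := 1) ENNReal.one_ne_top
    calc ∫⁻ x, ENNReal.ofReal (M x : ℝ) ∂P ≤ ∫⁻ x, 1 ∂P :=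
          lintegral_mono fun x => by simpa using (M x).2.2
      _ = 1 := by simp
  have I := lintegral_mono (μ := P) fun x => key (M x)
  rw [lintegral_add_right _ (hM'.const_mul c), lintegral_add_right _ (hΦM.const_mul c),
    lintegral_const_mul _ hM', lintegral_const_mul _ hΦM] at I
  have I2 := I.trans (add_le_add_right (mul_le_mul_right hE c) _)
  exact (ENNReal.add_le_add_iff_right (ENNReal.mul_ne_top hfin hψ)).1 I2

theorem aux_PhiSwap {Ω : Type*} [MeasurableSpace Ω] (P : Measure Ω) [IsProbabilityMeasure P]
    (M : Ω → Θ) (hM : Measurable M) (H : ℝ → ENNReal) (hH : Measurable H) :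
    ∫⁻ x, (∫⁻ z in Set.Iio (M x : ℝ), H z) ∂P = ∫⁻ z, H z * P {x | z < (M x : ℝ)} := by
  have hM' : Measurable (fun x => (M x : ℝ)) := measurable_subtype_coe.comp hM
  have hset : MeasurableSet {p : Ω × ℝ | p.2 < (M p.1 : ℝ)} :=
    measurableSet_lt measurable_snd (hM'.comp measurable_fst)
  have e1 : ∀ x, ∫⁻ z in Set.Iio (M x : ℝ), H z =
      ∫⁻ z, {p : Ω × ℝ | p.2 < (M p.1 : ℝ)}.indicator (fun p => H p.2) (x, z) := by
    intro x
    rw [← lintegral_indicator measurableSet_Iio]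
    rfl
  simp_rw [e1]
  rw [lintegral_lintegral_swap]
  · congr 1
    ext z
    have hz : MeasurableSet {x | z < (M x : ℝ)} := measurableSet_lt measurable_const hM'
    rw [← lintegral_indicator_const hz]
    rfl
  · exact ((hH.comp measurable_snd).indicator hset).aemeasurable

/-- monotone `H` on (0,1): the crossing property of its primitive. -/
theorem aux_convex (H : ℝ → ENNReal) (hH0 : ∀ z, z ≤ 0 → H z = 0)
    (hmono : MonotoneOn H (Set.Ioo 0 1)) (m m' : ℝ) (hm : 0 ≤ m) (hmm : m < m') (hm' : m' ≤ 1)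
    (h : ∫⁻ z in Set.Iio m', H z ≤ ENNReal.ofReal m') :
    ∫⁻ z in Set.Iio m, H z ≤ ENNReal.ofReal m := by
  have z0 : ∀ t : ℝ, 0 ≤ t → ∫⁻ z in Set.Iio t, H z = ∫⁻ z in Set.Ioo 0 t, H z := by
    intro t ht
    rw [← Set.Ioi_inter_Iio, ← Measure.restrict_restrict measurableSet_Ioi]
    rw [← lintegral_indicator measurableSet_Ioi]
    congr 1
    ext z
    by_cases hz : z ∈ Set.Ioi (0:ℝ)
    · rw [Set.indicator_of_mem hz]
    · rw [Set.indicator_of_notMem hz, hH0 z (not_lt.1 hz)]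
  rcases hm.eq_or_lt with rfl | hm0
  · rw [z0 0 le_rfl]; simp
  have hmI : m ∈ Set.Ioo (0:ℝ) 1 := ⟨hm0, hmm.trans_le hm'⟩
  by_contra hcon
  rw [not_le] at hcon
  have hle : ∫⁻ z in Set.Iio m, H z ≤ H m * ENNReal.ofReal m := by
    rw [z0 m hm]
    calc ∫⁻ z in Set.Ioo 0 m, H z ≤ ∫⁻ z in Set.Ioo 0 m, H m :=
          setLIntegral_mono' measurableSet_Ioo fun z hz =>
            hmono ⟨hz.1, hz.2.trans hmI.2⟩ hmI hz.2.le
      _ = _ := by simp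
  have h1 : 1 ≤ H m := by
    by_contra hlt
    rw [not_le] at hlt
    have : H m * ENNReal.ofReal m ≤ 1 * ENNReal.ofReal m := by gcongr
    rw [one_mul] at this
    exact absurd (hcon.trans_le (hle.trans this)) (lt_irrefl _)
  have h2 : ENNReal.ofReal (m' - m) ≤ ∫⁻ z in Set.Ico m m', H z := by
    rw [setLIntegral_congr Ioo_ae_eq_Ico.symm]
    calc ENNReal.ofReal (m' - m) = ∫⁻ z in Set.Ioo m m', 1 := by simp
      _ ≤ _ := setLIntegral_mono' measurableSet_Ioo fun z hz =>
            h1.trans (hmono hmI ⟨hm0.trans hz.1, hz.2.trans_le hm'⟩ hz.1.le)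
  have h3 : ∫⁻ z in Set.Iio m', H z = (∫⁻ z in Set.Iio m, H z) + ∫⁻ z in Set.Ico m m', H z := by
    rw [← Set.Iio_union_Ico_eq_Iio hmm.le]
    apply lintegral_union measurableSet_Ico
    rw [Set.disjoint_left]
    intro a ha hb
    exact absurd hb.1 (not_le.2 ha)
  have h4 : ENNReal.ofReal m' = ENNReal.ofReal m + ENNReal.ofReal (m' - m) := by
    rw [← ENNReal.ofReal_add hm (by linarith)]; congr 1; ring
  rw [h3, h4] at h
  have h5 := ENNReal.add_lt_add_of_lt_of_le ENNReal.ofReal_ne_top hcon h2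
  exact absurd (h5.trans_le h) (lt_irrefl _)

theorem aux_m0 (Φ : Θ → ENNReal)
    (hconv : ∀ m m' : Θ, m < m' → Φ m' ≤ ENNReal.ofReal m' → Φ m ≤ ENNReal.ofReal m)
    (a : Θ) (ha : 0 < a) (hΦa : Φ a ≤ ENNReal.ofReal a) :
    ∃ m0 : Θ, 0 < m0 ∧ (∀ m < m0, Φ m ≤ ENNReal.ofReal m) ∧
      (∀ m, m0 < m → ENNReal.ofReal m ≤ Φ m) := by
  refine ⟨sSup {m | Φ m ≤ ENNReal.ofReal m}, ha.trans_le (le_sSup hΦa), ?_, ?_⟩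
  · intro m hm
    obtain ⟨b, hb, hmb⟩ := lt_sSup_iff.1 hm
    exact hconv m b hmb hb
  · intro m hm
    by_contra h
    have hmem : m ∈ {m : Θ | Φ m ≤ ENNReal.ofReal m} := (not_le.1 h).le
    exact absurd (le_sSup hmem) (not_le.2 hm)

theorem aux_parts (f : ℝ → ℝ)
    (hf_cont : ContinuousOn f (Set.Icc 0 1))
    (hf_pos : ∀ z ∈ Set.Icc (0:ℝ) 1, 0 < f z)
    (F : ℝ → ℝ) (hFc : ContinuousOn F (Set.Icc 0 1))
    (hFd : ∀ z ∈ Set.Ioo (0:ℝ) 1, HasDerivAt F (f z) z)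
    (hF1 : F 1 = 1) (hFlt : ∀ θ : ℝ, 0 ≤ θ → θ < 1 → F θ < 1) :
    ∫⁻ z in Set.Ioo (0:ℝ) 1, ENNReal.ofReal (2 * z * f z * (1 - F z)) ≤
    ∫⁻ z in Set.Ioo (0:ℝ) 1, ENNReal.ofReal ((1 - F z) ^ 2) := by
  have c1 : ContinuousOn (fun z => 2 * z * f z * (1 - F z)) (Set.Icc 0 1) := by fun_prop
  have c2 : ContinuousOn (fun z => (1 - F z) ^ 2) (Set.Icc 0 1) := by fun_prop
  have i1 := (c1.integrableOn_compact (μ := volume) isCompact_Icc).mono_set Set.Ioo_subset_Icc_self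
  have i2 := (c2.integrableOn_compact (μ := volume) isCompact_Icc).mono_set Set.Ioo_subset_Icc_self
  have hFle : ∀ z ∈ Set.Icc (0:ℝ) 1, F z ≤ 1 := by
    intro z hz
    rcases hz.2.eq_or_lt with h | h
    · rw [h, hF1]
    · exact (hFlt z hz.1 h).le
  rw [← ofReal_integral_eq_lintegral_ofReal i1, ← ofReal_integral_eq_lintegral_ofReal i2]
  · apply ENNReal.ofReal_le_ofReal
    rw [← integral_Ioc_eq_integral_Ioo, ← integral_Ioc_eq_integral_Ioo,
      ← intervalIntegral.integral_of_le zero_le_one, ← intervalIntegral.integral_of_le zero_le_one]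
    have j1 : IntervalIntegrable (fun z => 2 * z * f z * (1 - F z)) volume 0 1 :=
      ContinuousOn.intervalIntegrable (by rwa [Set.uIcc_of_le zero_le_one])
    have j2 : IntervalIntegrable (fun z => (1 - F z) ^ 2) volume 0 1 :=
      ContinuousOn.intervalIntegrable (by rwa [Set.uIcc_of_le zero_le_one])
    have k := intervalIntegral.integral_eq_sub_of_hasDerivAt_of_le
      (f := fun z => z * (1 - F z) ^ 2)
      (f' := fun z => (1 - F z) ^ 2 - 2 * z * f z * (1 - F z))
      (a := 0) (b := 1) zero_le_one (by fun_prop) (by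
        intro z hz
        have := (hasDerivAt_id z).mul (((hFd z hz).const_sub 1).pow 2)
        refine this.congr_deriv ?_
        simp
        ring) (j2.sub j1)
    rw [intervalIntegral.integral_sub j2 j1] at k
    simp only [hF1] at k
    linarith
  · exact Filter.Eventually.of_forall fun z => sq_nonneg _
  · filter_upwards [ae_restrict_mem measurableSet_Ioo] with z hz
    have hz' := Set.Ioo_subset_Icc_self hz
    have := hf_pos z hz'
    have := hFle z hz'
    have := hz.1
    have : 0 ≤ 1 - F z := by linarith
    show 0 ≤ _
    positivity

theorem stmt6
    (f : ℝ → ℝ)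
    (hf_cont : ContinuousOn f (Set.Icc 0 1))
    (hf_pos : ∀ z ∈ Set.Icc (0:ℝ) 1, 0 < f z)
    (F : ℝ → ℝ) (hF : ∀ θ : ℝ, F θ = ∫ z in (0:ℝ)..θ, f z)
    (hF1 : F 1 = 1)
    (hFlt : ∀ θ : ℝ, 0 ≤ θ → θ < 1 → F θ < 1)
    -- the type-weighted hazard rate is nondecreasing on (0,1)
    (hhaz : MonotoneOn (fun θ : ℝ => θ * f θ / (1 - F θ)) (Set.Ioo 0 1))
    -- μF is the probability measure on [0,1] associated with the cdf F
    (μF : Measure Θ) [IsProbabilityMeasure μF]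
    (hμF : ∀ c : Θ, μF {x : Θ | x ≤ c} = ENNReal.ofReal (F (c : ℝ)))
    (P : Measure (Θ × Θ)) (hP : P = μF.prod μF)
    (𝒬 : Set (Measure (Θ × Θ)))
    (hP𝒬 : P ∈ 𝒬)
    (h𝒬 : ∀ Q ∈ 𝒬, IsProbabilityMeasure Q ∧ Q ≪ P)
    -- rearrangement invariance of 𝒬
    (hinv : ∀ Q ∈ 𝒬, ∀ Q' : Measure (Θ × Θ), IsProbabilityMeasure Q' → Q' ≪ P →
      IsRearrangement P Q Q' → Q' ∈ 𝒬)
    -- war-of-attrition equilibrium bid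
    (bW : ℝ → ℝ)
    (hbW : ∀ θ : ℝ, bW θ = ∫ z in (0:ℝ)..θ, z * f z / (1 - F z))
    -- second-price and war-of-attrition transfer functions
    (tII tW : Θ → Θ → ℝ)
    (htII : ∀ θ θ' : Θ, tII θ θ' =
      (θ' : ℝ) * ((if θ' < θ then (1:ℝ) else 0) + (if θ = θ' then 1/2 else 0)))
    (htW : ∀ θ θ' : Θ, tW θ θ' = if θ' < θ then bW (θ' : ℝ) else bW (θ : ℝ)) :
    (⨅ Q ∈ 𝒬, ∫⁻ x : Θ × Θ, ENNReal.ofReal (tW x.1 x.2 + tW x.2 x.1) ∂Q)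
      ≤ ⨅ Q ∈ 𝒬, ∫⁻ x : Θ × Θ, ENNReal.ofReal (tII x.1 x.2 + tII x.2 x.1) ∂Q := by
  -- basic facts on F
  have hfi : IntegrableOn f (Set.Icc 0 1) := hf_cont.integrableOn_compact isCompact_Icc
  have hFc : ContinuousOn F (Set.Icc 0 1) := by
    have := intervalIntegral.continuousOn_primitive_interval (μ := volume) (f := f) (a := 0) (b := 1)
      (by rwa [Set.uIcc_of_le zero_le_one])
    rw [Set.uIcc_of_le zero_le_one] at this
    exact this.congr fun x _ => hF x
  have hFd : ∀ z ∈ Set.Ioo (0:ℝ) 1, HasDerivAt F (f z) z := by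
    intro z hz
    have hFe : F = fun θ => ∫ z in (0:ℝ)..θ, f z := funext hF
    rw [hFe]
    have hnhds : Set.Icc (0:ℝ) 1 ∈ nhds z := Icc_mem_nhds hz.1 hz.2
    apply intervalIntegral.integral_hasDerivAt_right
    · rw [intervalIntegrable_iff_integrableOn_Icc_of_le hz.1.le]
      exact hfi.mono_set (Set.Icc_subset_Icc_right hz.2.le)
    · exact ⟨Set.Icc 0 1, hnhds, hfi.aestronglyMeasurable⟩
    · exact hf_cont.continuousAt hnhds
  have hF0 : F 0 = 0 := by rw [hF]; simp
  have hFmono : StrictMonoOn F (Set.Icc 0 1) := by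
    apply strictMonoOn_of_deriv_pos (convex_Icc 0 1) hFc
    intro z hz
    rw [interior_Icc] at hz
    rw [(hFd z hz).deriv]
    exact hf_pos z (Set.Ioo_subset_Icc_self hz)
  have hFle : ∀ z ∈ Set.Icc (0:ℝ) 1, F z ≤ 1 := by
    intro z hz
    rw [← hF1]
    exact hFmono.monotoneOn hz ⟨zero_le_one, le_rfl⟩ hz.2
  have hF0le : ∀ z ∈ Set.Icc (0:ℝ) 1, 0 ≤ F z := by
    intro z hz
    rw [← hF0]
    exact hFmono.monotoneOn ⟨le_rfl, zero_le_one⟩ hz hz.1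
  have hPprob : IsProbabilityMeasure P := by rw [hP]; infer_instance
  -- the minimum
  let M : Θ × Θ → Θ := fun x => min x.1 x.2
  have hM : Measurable M := measurable_fst.min measurable_snd
  have hgt : ∀ m : Θ, P {x | m < M x} = ENNReal.ofReal ((1 - F m) ^ 2) := by
    intro m
    have e : {x : Θ × Θ | m < M x} = Set.Ioi m ×ˢ Set.Ioi m := by
      ext x; simp [M]
    have e2 : μF (Set.Ioi m) = ENNReal.ofReal (1 - F m) := by
      rw [← Set.compl_Iic, prob_compl_eq_one_sub measurableSet_Iic]
      have := hμF m
      change μF (Set.Iic m) = _ at this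
      rw [this, ENNReal.ofReal_sub _ (hF0le m m.2), ENNReal.ofReal_one]
    rw [e, hP, Measure.prod_prod, e2, ← ENNReal.ofReal_mul (by linarith [hFle m m.2]), sq]
  let s : Θ → ENNReal := fun m => ENNReal.ofReal (1 - (1 - F m) ^ 2)
  have hsP : ∀ m, P {x | M x ≤ m} = s m := by
    intro m
    have hB : MeasurableSet {x | m < M x} := measurableSet_lt measurable_const hM
    have : {x | M x ≤ m} = {x | m < M x}ᶜ := by ext x; simp
    rw [this, prob_compl_eq_one_sub hB, hgt, ← ENNReal.ofReal_one,
      ← ENNReal.ofReal_sub _ (sq_nonneg _)]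
  have hs : StrictMono s := by
    intro a b hab
    have h1 := hFmono a.2 b.2 hab
    have h2 := hFle b b.2
    have h3 := hF0le a a.2
    apply (ENNReal.ofReal_lt_ofReal_iff _).2
    · nlinarith
    · nlinarith
  have hsurj : ∀ u : ENNReal, u ≤ 1 → ∃ m, s m = u := by
    intro u hu
    have hut : u ≠ ⊤ := ne_top_of_le_ne_top ENNReal.one_ne_top hu
    have hu1 : u.toReal ≤ 1 := by
      simpa using ENNReal.toReal_mono ENNReal.one_ne_top hu
    have hc : ContinuousOn (fun z => 1 - (1 - F z) ^ 2) (Set.Icc 0 1) := by fun_prop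
    have := intermediate_value_Icc zero_le_one hc
    obtain ⟨z, hz, hzu⟩ := this (show u.toReal ∈ _ by
      simp only [hF0, hF1]; constructor <;> norm_num [hu1])
    refine ⟨⟨z, hz⟩, ?_⟩
    simp only [s]
    simp only at hzu
    rw [hzu, ENNReal.ofReal_toReal hut]
  -- the marginal function
  let h : ℝ → ℝ := fun z => z * f z / (1 - F z)
  have hcont : ContinuousOn (fun z => 2 * h z) (Set.Ico 0 1) := by
    have a1 := hf_cont.mono Set.Ico_subset_Icc_self
    have a2 := hFc.mono Set.Ico_subset_Icc_self
    have : ContinuousOn h (Set.Ico 0 1) :=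
      (continuousOn_id.mul a1).div (continuousOn_const.sub a2) (by
        intro z hz
        have := hFlt z hz.1 hz.2
        exact (sub_pos.2 this).ne')
    exact continuousOn_const.mul this
  have hnn : ∀ z ∈ Set.Ioo (0:ℝ) 1, 0 ≤ h z := by
    intro z hz
    have h1 := hf_pos z (Set.Ioo_subset_Icc_self hz)
    have h2 := hFlt z hz.1.le hz.2
    have h3 := hz.1
    apply div_nonneg (by positivity) (by linarith)
  let H : ℝ → ENNReal := (Set.Ioo (0:ℝ) 1).indicator (fun z => ENNReal.ofReal (2 * h z))
  have hHmeas : Measurable H := by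
    have c : ContinuousOn (fun z => ENNReal.ofReal (2 * h z)) (Set.Ioo 0 1) :=
      ENNReal.continuous_ofReal.comp_continuousOn (hcont.mono Set.Ioo_subset_Ico_self)
    classical
    have := c.measurable_piecewise (g := (0 : ℝ → ENNReal)) continuousOn_const measurableSet_Ioo
    rwa [Set.piecewise_eq_indicator] at this
  have hH0 : ∀ z, z ≤ 0 → H z = 0 := by
    intro z hz
    apply Set.indicator_of_notMem
    intro hz'
    exact absurd hz'.1 (not_lt.2 hz)
  have hHI : ∀ z ∈ Set.Ioo (0:ℝ) 1, H z = ENNReal.ofReal (2 * h z) :=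
    fun z hz => Set.indicator_of_mem hz _
  have hHmono : MonotoneOn H (Set.Ioo 0 1) := by
    intro a ha b hb hab
    rw [hHI a ha, hHI b hb]
    apply ENNReal.ofReal_le_ofReal
    have := hhaz ha hb hab
    change h a ≤ h b at this
    linarith
  let Φ : Θ → ENNReal := fun m => ∫⁻ z in Set.Iio (m:ℝ), H z
  have hΦmono : Monotone Φ := fun a b hab =>
    lintegral_mono_set (Set.Iio_subset_Iio hab)
  have hbΦ : ∀ m : Θ, ENNReal.ofReal (2 * bW m) ≤ Φ m := by
    intro m
    rw [hbW, ← intervalIntegral.integral_const_mul, intervalIntegral.integral_of_le m.2.1,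
      integral_Ioc_eq_integral_Ioo]
    refine (Real.ofReal_le_enorm _).trans ((enorm_integral_le_lintegral_enorm _).trans ?_)
    calc ∫⁻ z in Set.Ioo 0 (m:ℝ), ‖2 * (z * f z / (1 - F z))‖ₑ
        = ∫⁻ z in Set.Ioo 0 (m:ℝ), H z := by
          apply setLIntegral_congr_fun measurableSet_Ioo
          intro z hz
          have hz' : z ∈ Set.Ioo (0:ℝ) 1 := ⟨hz.1, hz.2.trans_le m.2.2⟩
          simp only
          rw [hHI z hz', Real.enorm_of_nonneg]
          have := hnn z hz'
          change 0 ≤ 2 * h z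
          positivity
      _ ≤ Φ m := lintegral_mono_set Set.Ioo_subset_Iio_self
  have hconv : ∀ m m' : Θ, m < m' → Φ m' ≤ ENNReal.ofReal m' → Φ m ≤ ENNReal.ofReal m :=
    fun m m' hmm => aux_convex H hH0 hHmono m m' m.2.1 hmm m'.2.2
  -- a point where Φ is below the identity
  obtain ⟨a, ha, hΦa⟩ : ∃ a : Θ, 0 < a ∧ Φ a ≤ ENNReal.ofReal a := by
    have hlt : ∀ᶠ z in nhdsWithin (0:ℝ) (Set.Ioi 0), 2 * h z < 1 := by
      have h0 : ContinuousWithinAt (fun z => 2 * h z) (Set.Ico 0 1) 0 :=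
        hcont 0 ⟨le_rfl, zero_lt_one⟩
      have h1 := h0.mono (Set.Ioo_subset_Ico_self)
      have h2 : ∀ᶠ z in nhdsWithin (0:ℝ) (Set.Ioo 0 1), 2 * h z < 1 := by
        apply h1.eventually_lt_const
        simp [h]
      rwa [nhdsWithin_Ioo_eq_nhdsGT zero_lt_one] at h2
    obtain ⟨a, ha1, ha⟩ := (hlt.and (Ioo_mem_nhdsGT zero_lt_one)).exists
    refine ⟨⟨a, ha.1.le, ha.2.le⟩, ha.1, ?_⟩
    calc Φ ⟨a, ha.1.le, ha.2.le⟩ = ∫⁻ z in Set.Iio a, H z := rfl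
      _ ≤ ∫⁻ z in Set.Iio a, (Set.Ioo 0 a).indicator (fun _ => 1) z := by
          apply setLIntegral_mono' measurableSet_Iio
          intro z hz
          by_cases hz0 : 0 < z
          · rw [Set.indicator_of_mem (show z ∈ Set.Ioo 0 a from ⟨hz0, hz⟩)]
            have hz1 : z < a := hz
            refine (hHmono ⟨hz0, hz1.trans ha.2⟩ ha hz1.le).trans ?_
            rw [hHI a ha]
            exact ENNReal.ofReal_le_one.2 ha1.le
          · rw [hH0 z (not_lt.1 hz0)]
            exact zero_le
      _ ≤ ∫⁻ z, (Set.Ioo 0 a).indicator (fun _ => 1) z :=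
          lintegral_mono' Measure.restrict_le_self le_rfl
      _ = ENNReal.ofReal a := by
          rw [lintegral_indicator measurableSet_Ioo]; simp
  obtain ⟨m0, hm0, hc1, hc2⟩ := aux_m0 Φ hconv a ha hΦa
  -- revenue equivalence under P
  have hPz : ∀ z ∈ Set.Ioo (0:ℝ) 1, P {x | z < (M x : ℝ)} = ENNReal.ofReal ((1 - F z) ^ 2) :=
    fun z hz => hgt ⟨z, hz.1.le, hz.2.le⟩
  have hM' : Measurable (fun x => (M x : ℝ)) := measurable_subtype_coe.comp hM
  have hE : ∫⁻ x, Φ (M x) ∂P ≤ ∫⁻ x, ENNReal.ofReal (M x : ℝ) ∂P := by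
    calc ∫⁻ x, Φ (M x) ∂P = ∫⁻ z, H z * P {x | z < (M x : ℝ)} := aux_PhiSwap P M hM H hHmeas
      _ = ∫⁻ z, (Set.Ioo (0:ℝ) 1).indicator
            (fun z => ENNReal.ofReal (2 * z * f z * (1 - F z))) z := by
          congr 1
          ext z
          by_cases hz : z ∈ Set.Ioo (0:ℝ) 1
          · have h2 := hFlt z hz.1.le hz.2
            have h3 : 1 - F z ≠ 0 := by linarith
            rw [Set.indicator_of_mem hz, hHI z hz, hPz z hz, ← ENNReal.ofReal_mul]
            · congr 1
              simp only [h]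
              field_simp
            · have := hnn z hz
              positivity
          · rw [Set.indicator_of_notMem hz]
            simp only [H]
            rw [Set.indicator_of_notMem hz, zero_mul]
      _ = ∫⁻ z in Set.Ioo (0:ℝ) 1, ENNReal.ofReal (2 * z * f z * (1 - F z)) :=
          lintegral_indicator measurableSet_Ioo _
      _ ≤ ∫⁻ z in Set.Ioo (0:ℝ) 1, ENNReal.ofReal ((1 - F z) ^ 2) :=
          aux_parts f hf_cont hf_pos F hFc hFd hF1 hFlt
      _ = ∫⁻ z in Set.Ioo (0:ℝ) 1, P {x | z < (M x : ℝ)} :=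
          setLIntegral_congr_fun measurableSet_Ioo fun z hz => (hPz z hz).symm
      _ ≤ ∫⁻ z in Set.Ioi (0:ℝ), P {x | z < (M x : ℝ)} :=
          lintegral_mono_set Set.Ioo_subset_Ioi_self
      _ = _ := (lintegral_eq_lintegral_meas_lt P
          (Filter.Eventually.of_forall fun x => (M x).2.1) hM'.aemeasurable).symm
  -- transfers
  have hII : ∀ x : Θ × Θ, tII x.1 x.2 + tII x.2 x.1 = (M x : ℝ) := by
    rintro ⟨x, y⟩
    simp only [htII, M]
    rcases lt_trichotomy x y with hxy | hxy | hxy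
    · simp [hxy, hxy.le, hxy.not_gt, hxy.ne, hxy.ne']
    · subst hxy; simp; ring
    · simp [hxy, hxy.le, hxy.not_gt, hxy.ne, hxy.ne']
  have hW : ∀ x : Θ × Θ, tW x.1 x.2 + tW x.2 x.1 = 2 * bW (M x : ℝ) := by
    rintro ⟨x, y⟩
    simp only [htW, M]
    rcases lt_trichotomy x y with hxy | hxy | hxy
    · simp [hxy, hxy.le, hxy.not_gt]; ring
    · subst hxy; simp; ring
    · simp [hxy, hxy.le, hxy.not_gt]; ring
  simp_rw [hII, hW]
  -- main argument
  refine le_iInf₂ fun Q hQ => ?_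
  obtain ⟨hQp, hQP⟩ := h𝒬 Q hQ
  have : SigmaFinite P := inferInstance
  have : SFinite Q := inferInstance
  have : Q.HaveLebesgueDecomposition P := inferInstance
  let q := Q.rnDeriv P
  have hq : Measurable q := Measure.measurable_rnDeriv Q P
  have hQq : P.withDensity q = Q := Measure.withDensity_rnDeriv_eq Q P hQP
  obtain ⟨g, hg, hmap⟩ := aux_rearr_s6 P M hM s hs hsP hsurj q hq
  have hgM : Measurable (fun x => g (M x)) := hg.measurable.comp hM
  let Q' := P.withDensity (fun x => g (M x))
  have hq1 : ∫⁻ x, q x ∂P = 1 := by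
    have : P.withDensity q Set.univ = 1 := by rw [hQq]; exact measure_univ
    rwa [withDensity_apply _ MeasurableSet.univ, Measure.restrict_univ] at this
  have hg1 : ∫⁻ x, g (M x) ∂P = 1 := by
    have e1 := lintegral_map (μ := P) (f := fun y : ENNReal => y) measurable_id hq
    have e2 := lintegral_map (μ := P) (f := fun y : ENNReal => y) measurable_id hgM
    rw [← e2, ← hmap, e1, hq1]
  have hQ'p : IsProbabilityMeasure Q' := ⟨by
    rw [withDensity_apply _ MeasurableSet.univ, Measure.restrict_univ, hg1]⟩
  have hQ'P : Q' ≪ P := withDensity_absolutelyContinuous _ _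
  have hrn : Q'.rnDeriv P =ᵐ[P] fun x => g (M x) := Measure.rnDeriv_withDensity P hgM
  have hrearr : IsRearrangement P Q Q' := by
    intro c
    have e1 : P {ω | Q'.rnDeriv P ω ≤ c} = P {ω | g (M ω) ≤ c} := by
      apply measure_congr
      filter_upwards [hrn] with x hx
      change (Q'.rnDeriv P x ≤ c) = (g (M x) ≤ c)
      rw [hx]
    rw [e1]
    have e2 := Measure.map_apply (μ := P) hgM (measurableSet_Iic (a := c))
    have e3 := Measure.map_apply (μ := P) hq (measurableSet_Iic (a := c))
    rw [hmap, e2] at e3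
    exact e3
  have hQ' : Q' ∈ 𝒬 := hinv Q hQ Q' hQ'p hQ'P hrearr
  have hfin : g m0 ≠ ⊤ := by
    intro htop
    have h1 : P {x | M x ≤ m0} ≤ P {x | ¬ g (M x) < ⊤} := by
      apply measure_mono
      intro x hx
      have : g m0 ≤ g (M x) := hg hx
      rw [htop] at this
      exact not_lt.2 this
    have h2 : P {x | ¬ g (M x) < ⊤} = 0 :=
      ae_lt_top hgM (by rw [hg1]; exact ENNReal.one_ne_top)
    rw [h2, hsP] at h1
    exact absurd ((hs hm0).trans_le h1) not_lt_zero
  calc _ ≤ ∫⁻ x : Θ × Θ, ENNReal.ofReal (2 * bW (M x)) ∂Q' := iInf₂_le Q' hQ'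
    _ ≤ ∫⁻ x, Φ (M x) ∂Q' := lintegral_mono fun x => hbΦ (M x)
    _ = ∫⁻ x, g (M x) * Φ (M x) ∂P :=
        lintegral_withDensity_eq_lintegral_mul P hgM (hΦmono.measurable.comp hM)
    _ ≤ ∫⁻ x, g (M x) * ENNReal.ofReal (M x : ℝ) ∂P :=
        aux_cross P M hM g hg Φ hΦmono.measurable m0 hfin hc1 hc2 hE
    _ = ∫⁻ x, ENNReal.ofReal (M x : ℝ) ∂Q' :=
        (lintegral_withDensity_eq_lintegral_mul P hgM hM'.ennreal_ofReal).symm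
    _ ≤ ∫⁻ x, ENNReal.ofReal (M x : ℝ) ∂Q := by
        apply aux_HL Q Q' M hM
        intro m
        have hB : MeasurableSet {x | M x ≤ m} := measurableSet_le hM measurable_const
        have := aux_bath P M hM q hq g hg hmap m
        rwa [← withDensity_apply _ hB, ← withDensity_apply _ hB, hQq] at this

end
end
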